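/- Let Φ : U₂ → U₂ satisfy rank(U − V) ≤ 1 ⟹ rank(Φ(U) − Φ(V)) ≤ 1 for all U, V ∈ U₂. Then either Φ is an automorphism of U₂ (a bijection with rank(U − V) ≤ 1 ⟺ rank(Φ(U) − Φ(V)) ≤ 1 for all U, V), or Φ is degenerate: either there exist A ∈ U₂ and B in the image Φ(U₂) such that rank(Φ(U) − B) ≤ 1 for every U ∈ U₂ with U ≠ A, or there exist lines ℓ, ℓ' in U₂ such that Φ(U) ∈ ℓ' for every U ∈ U₂ with U ∉ ℓ. -/

import Mathlib

open Matrix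
open scoped ComplexOrder

noncomputable section

/-- The space of `2×2` complex matrices. -/
abbrev Mat2 : Type := Matrix (Fin 2) (Fin 2) ℂ

/-- The group of `2×2` complex unitary matrices. -/
abbrev U2 : Type := Matrix.unitaryGroup (Fin 2) ℂ

/-- Coherency for matrices: `A ∼ B` iff `rank (A − B) ≤ 1`. -/
def Coherent (A B : Mat2) : Prop := (A - B).rank ≤ 1

/-- Coherency for unitaries: `U ∼ V` iff `rank (U − V) ≤ 1`. -/
def CoherentU (U V : U2) : Prop := ((U : Mat2) - (V : Mat2)).rank ≤ 1

/-- The Cayley transform, as a matrix: `𝔠(A) = (A − iI)(A + iI)⁻¹`. -/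
def cayleyMat (A : Mat2) : Mat2 :=
  (A - Complex.I • (1 : Mat2)) * (A + Complex.I • (1 : Mat2))⁻¹

open Classical in
/-- The Cayley transform, landing in the unitary group.  For every hermitian `A` the matrix
`cayleyMat A` is unitary, so the junk value `1` is never used for the matrices considered here. -/
def cayley (A : Mat2) : U2 :=
  if h : cayleyMat A ∈ Matrix.unitaryGroup (Fin 2) ℂ then ⟨cayleyMat A, h⟩ else 1

/-- An automorphism of `U₂`: a bijection preserving coherency in both directions. -/
def IsAut (Φ : U2 → U2) : Prop :=
  Function.Bijective Φ ∧ ∀ U V : U2, CoherentU U V ↔ CoherentU (Φ U) (Φ V)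

/-- A line in `U₂`: a maximal subset all of whose elements are pairwise coherent. -/
def IsLine (ℓ : Set U2) : Prop :=
  (∀ U ∈ ℓ, ∀ V ∈ ℓ, CoherentU U V) ∧
  ∀ m : Set U2, ℓ ⊆ m → (∀ U ∈ m, ∀ V ∈ m, CoherentU U V) → m = ℓ

/-- The matrix interval `[A, B] = {X : A ≤ X ≤ B}` (in the Loewner order). -/
def matIcc (A B : Mat2) : Set Mat2 := {X | (X - A).PosSemidef ∧ (B - X).PosSemidef}

/-- Rank one projections: `P = P* = P²` of rank one. -/
def IsProj1 (P : Mat2) : Prop := P.IsHermitian ∧ P * P = P ∧ P.rank = 1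

section

/-- Minkowski space, in coordinates in which the Lorentz form is the polarization of the determinant
of the hermitian matrix with diagonal entries `A.1`, `A.2.1` and off-diagonal entry `A.2.2`. -/
abbrev Mink : Type := ℝ × ℝ × ℂ

namespace Mink

/-- The Lorentz form; `ip A A` is twice the determinant. -/
def ip (A B : Mink) : ℝ :=
  A.1 * B.2.1 + A.2.1 * B.1 - 2 * (A.2.2.re * B.2.2.re + A.2.2.im * B.2.2.im)

lemma ip_comm (A B : Mink) : ip A B = ip B A := by
  simp only [ip]; ring

lemma ip_add_left (A B D : Mink) : ip (A + B) D = ip A D + ip B D := by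
  simp only [ip, Prod.fst_add, Prod.snd_add, Complex.add_re, Complex.add_im]; ring

lemma ip_sub_left (A B D : Mink) : ip (A - B) D = ip A D - ip B D := by
  simp only [ip, Prod.fst_sub, Prod.snd_sub, Complex.sub_re, Complex.sub_im]; ring

lemma ip_smul_left (k : ℝ) (A B : Mink) : ip (k • A) B = k * ip A B := by
  simp only [ip, Prod.smul_fst, Prod.smul_snd, Complex.real_smul, Complex.re_ofReal_mul,
    Complex.im_ofReal_mul, smul_eq_mul]; ring

lemma ip_add_right (A B D : Mink) : ip A (B + D) = ip A B + ip A D := by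
  rw [ip_comm, ip_add_left, ip_comm B, ip_comm D]

lemma ip_sub_right (A B D : Mink) : ip A (B - D) = ip A B - ip A D := by
  rw [ip_comm, ip_sub_left, ip_comm B, ip_comm D]

lemma ip_smul_right (k : ℝ) (A B : Mink) : ip A (k • B) = k * ip A B := by
  rw [ip_comm, ip_smul_left, ip_comm]

/-- The null direction with parameter in the Riemann sphere `ℂ ∪ {∞}`. -/
def dir : Option ℂ → Mink
  | none => (1, 0, 0)
  | some z => (Complex.normSq z, 1, z)

lemma ip_dir_none (A : Mink) : ip (dir none) A = A.2.1 := by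
  simp [ip, dir]

lemma ip_dir_some_some (z w : ℂ) : ip (dir (some z)) (dir (some w)) = Complex.normSq (z - w) := by
  simp only [ip, dir, Complex.normSq_apply, Complex.sub_re, Complex.sub_im]; ring

lemma ip_dir_self (o : Option ℂ) : ip (dir o) (dir o) = 0 := by
  cases o with
  | none => simp [ip, dir]
  | some z => simp [ip_dir_some_some]

lemma ip_dir_ne_zero {o o' : Option ℂ} (h : o ≠ o') : ip (dir o) (dir o') ≠ 0 := by
  cases o with
  | none =>
    cases o' with
    | none => exact absurd rfl h
    | some w => simp [ip, dir]
  | some z =>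
    cases o' with
    | none => simp [ip, dir]
    | some w =>
      rw [ip_dir_some_some]
      simpa [sub_eq_zero] using h

/-- Every null vector is a multiple of a standard null direction. -/
lemma exists_smul_dir {n : Mink} (hn : ip n n = 0) : ∃ (k : ℝ) (o : Option ℂ), n = k • dir o := by
  obtain ⟨a, g, z⟩ := n
  simp only [ip] at hn
  by_cases hg : g = 0
  · subst hg
    refine ⟨a, none, ?_⟩
    have h : z.re ^ 2 + z.im ^ 2 = 0 := by linarith
    have h1 : z.re = 0 := by nlinarith [sq_nonneg z.re, sq_nonneg z.im]
    have h2 : z.im = 0 := by nlinarith [sq_nonneg z.re, sq_nonneg z.im]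
    have h3 : z = 0 := Complex.ext h1 h2
    simp [dir, h3]
  · refine ⟨g, some ((g⁻¹ : ℝ) • z), ?_⟩
    ext
    · simp only [dir, Prod.smul_fst, smul_eq_mul, Complex.normSq_apply, Complex.real_smul,
        Complex.re_ofReal_mul, Complex.im_ofReal_mul]
      field_simp
      linarith
    · simp [dir]
    · simp [dir, hg]

lemma dir_ne_zero (o : Option ℂ) : dir o ≠ 0 := by
  cases o <;> simp [dir, Prod.ext_iff]

/-- Every vector is a combination of four standard null directions. -/
lemma eq_sum_dir (A : Mink) : ∃ x y z w : ℝ, A = x • dir none + y • dir (some 0) +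
    z • dir (some 1) + w • dir (some Complex.I) := by
  obtain ⟨a, g, b⟩ := A
  refine ⟨a - b.re - b.im, g - b.re - b.im, b.re, b.im, ?_⟩
  ext <;> simp [dir] <;> ring

/-- The Lorentz form is nondegenerate, already when tested against null directions. -/
lemma exists_dir_ip_ne_zero {A : Mink} (hA : A ≠ 0) : ∃ o, ip (dir o) A ≠ 0 := by
  by_contra! h
  apply hA
  have h1 := h none
  have h2 := h (some 0)
  have h3 := h (some 1)
  have h4 := h (some Complex.I)
  simp [ip, dir] at h1 h2 h3 h4
  obtain ⟨a, g, b⟩ := A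
  simp only at h1 h2 h3 h4
  subst h1 h2
  have hb : b = 0 := Complex.ext (by simpa using h3) (by simpa using h4)
  simp [hb]

end Mink
end

section

/-- A multiplicatively closed set of reals containing a nondegenerate interval of positive numbers,
and closed under inversion, contains all positive numbers. -/
lemma pos_mem_of_interval_subset {L : Set ℝ} (hmul : ∀ x ∈ L, ∀ y ∈ L, x * y ∈ L)
    (hinv : ∀ x ∈ L, x⁻¹ ∈ L) {p q : ℝ} (hp : 0 < p) (hpq : p < q) (hI : Set.Icc p q ⊆ L)
    {y : ℝ} (hy : 0 < y) : y ∈ L := by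
  have hone : (1 : ℝ) ∈ L := by
    have := hmul _ (hI ⟨le_rfl, hpq.le⟩) _ (hinv _ (hI ⟨le_rfl, hpq.le⟩))
    rwa [mul_inv_cancel₀ hp.ne'] at this
  have hbase : ∀ x, 1 ≤ x → x ≤ q / p → x ∈ L := by
    intro x h1 h2
    have h3 : p * x ∈ L := hI ⟨by nlinarith, by rw [le_div_iff₀ hp] at h2; linarith⟩
    have := hmul _ (hinv _ (hI ⟨le_rfl, hpq.le⟩)) _ h3
    rwa [inv_mul_cancel_left₀ hp.ne'] at this
  have hpow : ∀ x ∈ L, ∀ m : ℕ, x ^ m ∈ L := by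
    intro x hx m
    induction m with
    | zero => simpa using hone
    | succ m ih => rw [pow_succ]; exact hmul _ ih _ hx
  have hge : ∀ x, 1 ≤ x → x ∈ L := by
    intro x hx
    have hqp : 1 < q / p := by rwa [one_lt_div hp]
    obtain ⟨m, hm⟩ := pow_unbounded_of_one_lt x hqp
    have hm0 : m ≠ 0 := by rintro rfl; simp at hm; linarith
    have h1 : x ^ ((m : ℝ)⁻¹) ≤ q / p := by
      have h2 : x ^ ((m : ℝ)⁻¹) ≤ ((q / p) ^ m) ^ ((m : ℝ)⁻¹) :=
        Real.rpow_le_rpow (by linarith) hm.le (by positivity)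
      rwa [Real.pow_rpow_inv_natCast (by linarith) hm0] at h2
    have h3 := hpow _ (hbase _ (Real.one_le_rpow hx (by positivity)) h1) m
    rwa [Real.rpow_inv_natCast_pow (by linarith) hm0] at h3
  rcases le_total 1 y with h | h
  · exact hge y h
  · have := hinv _ (hge y⁻¹ ((one_le_inv₀ hy).2 h))
    rwa [inv_inv] at this

open Complex in
/-- On a circle around the origin, the ratio of distances to two points is constant only if the
circle is an Apollonian circle of the two points. -/
lemma apollonian_of_const {u n : ℂ} (hun : u ≠ n) {r κ : ℝ} (hr : r ≠ 0)
    (h : ∀ z : ℂ, normSq z = r ^ 2 → normSq (z - n) = κ * normSq (z - u)) :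
    n = κ • u ∧ r ^ 2 = κ * normSq u := by
  have h1 := h r (by simp [sq])
  have h2 := h (-r) (by simp [sq])
  have h3 := h (r * I) (by simp [sq])
  have h4 := h (-(r * I)) (by simp [sq])
  simp [normSq_apply] at h1 h2 h3 h4
  have e1 : r * n.re = r * (κ * u.re) := by linarith
  have e2 : r * n.im = r * (κ * u.im) := by linarith
  have e1 := mul_left_cancel₀ hr e1
  have e2 := mul_left_cancel₀ hr e2
  have hn : n = κ • u := Complex.ext (by simpa using e1) (by simpa using e2)
  refine ⟨hn, ?_⟩
  have hκ : 1 - κ ≠ 0 := by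
    intro h0
    have : κ = 1 := by linarith
    subst this
    simp at hn
    exact hun hn.symm
  rw [e1, e2] at h1
  apply mul_left_cancel₀ hκ
  rw [normSq_apply]
  linarith

open Complex in
/-- A multiplicative group of reals containing all ratios of squared distances
from points outside a planar set `S` to points of `S` contains all positive reals. -/
lemma pos_mem_of_ratio_mem {L : Set ℝ} (hmul : ∀ x ∈ L, ∀ y ∈ L, x * y ∈ L)
    (hinv : ∀ x ∈ L, x⁻¹ ∈ L) {S : Set ℂ}
    (hS : ∀ w ∉ S, ∀ z ∈ S, ∀ u ∈ S, normSq (w - z) / normSq (w - u) ∈ L)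
    {u n w : ℂ} (hu : u ∈ S) (hn : n ∈ S) (hun : u ≠ n) (hw : w ∉ S) {y : ℝ} (hy : 0 < y) :
    y ∈ L := by
  by_contra hyL
  have hwu : w ≠ u := fun h => hw (h ▸ hu)
  have hwn : w ≠ n := fun h => hw (h ▸ hn)
  have hd : 0 < normSq (u - w) := normSq_pos.2 (sub_ne_zero.2 hwu.symm)
  have hone : (1 : ℝ) ∈ L := by
    have := hS w hw u hu u hu
    rwa [div_self] at this
    exact (normSq_pos.2 (sub_ne_zero.2 hwu)).ne'
  have key : ∀ ρ : ℝ, 0 < ρ → ρ ∉ L →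
      ∃ κ : ℝ, n - w = κ • (u - w) ∧ ρ = κ := by
    intro ρ hρ hρL
    set r : ℝ := Real.sqrt (ρ * normSq (u - w)) with hr
    have hr2 : r ^ 2 = ρ * normSq (u - w) := Real.sq_sqrt (by positivity)
    have hr0 : 0 < r := Real.sqrt_pos.2 (by positivity)
    have hout : ∀ z : ℂ, normSq z = r ^ 2 → w + z ∉ S := by
      intro z hz hzS
      apply hρL
      have := hS w hw _ hzS u hu
      rw [← normSq_neg (w - u), neg_sub] at this
      rwa [show w - (w + z) = -z by ring, normSq_neg, hz, hr2, mul_div_cancel_right₀ _ hd.ne']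
        at this
    have hmem : ∀ z : ℂ, normSq z = r ^ 2 →
        normSq (z - (n - w)) / normSq (z - (u - w)) ∈ L := by
      intro z hz
      have := hS _ (hout z hz) n hn u hu
      rwa [show w + z - n = z - (n - w) by ring, show w + z - u = z - (u - w) by ring] at this
    have hpos : ∀ z : ℂ, normSq z = r ^ 2 → 0 < normSq (z - (u - w)) := by
      intro z hz
      refine normSq_pos.2 fun h => hout z hz ?_
      rw [sub_eq_zero] at h
      rw [h]; simpa using hu
    have hpos' : ∀ z : ℂ, normSq z = r ^ 2 → 0 < normSq (z - (n - w)) := by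
      intro z hz
      refine normSq_pos.2 fun h => hout z hz ?_
      rw [sub_eq_zero] at h
      rw [h]; simpa using hn
    have hsph : ∀ z : ℂ, z ∈ Metric.sphere (0 : ℂ) r ↔ normSq z = r ^ 2 := by
      intro z
      rw [mem_sphere_zero_iff_norm, normSq_eq_norm_sq, sq_eq_sq₀ (norm_nonneg _) hr0.le]
    set f : ℂ → ℝ := fun z => normSq (z - (n - w)) / normSq (z - (u - w)) with hf
    have hcont : ContinuousOn f (Metric.sphere (0 : ℂ) r) := by
      apply ContinuousOn.div
      · exact (continuous_normSq.comp (by fun_prop)).continuousOn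
      · exact (continuous_normSq.comp (by fun_prop)).continuousOn
      · intro z hz
        exact (hpos z ((hsph z).1 hz)).ne'
    have hconn : IsPreconnected (f '' Metric.sphere (0 : ℂ) r) :=
      (isPreconnected_sphere (by simp [Complex.rank_real_complex]) 0 r).image f hcont
    have hlt : ∀ z z' : ℂ, normSq z = r ^ 2 → normSq z' = r ^ 2 → ¬ f z < f z' := by
      intro z z' hz hz' hlt
      apply hyL
      refine pos_mem_of_interval_subset hmul hinv (div_pos (hpos' z hz) (hpos z hz)) hlt ?_ hy
      intro t ht
      obtain ⟨z₁, hz₁, rfl⟩ :=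
        hconn.Icc_subset ⟨z, (hsph z).2 hz, rfl⟩ ⟨z', (hsph z').2 hz', rfl⟩ ht
      exact hmem z₁ ((hsph z₁).1 hz₁)
    have hconst : ∀ z : ℂ, normSq z = r ^ 2 →
        normSq (z - (n - w)) = f r * normSq (z - (u - w)) := by
      intro z hz
      have hr' : normSq (r : ℂ) = r ^ 2 := by simp [sq]
      have : f r = f z := le_antisymm (not_lt.1 (hlt _ _ hz hr')) (not_lt.1 (hlt _ _ hr' hz))
      rw [this, hf]
      simp only
      rw [div_mul_cancel₀ _ (hpos z hz).ne']
    obtain ⟨h1, h2⟩ := apollonian_of_const (by simpa using hun) hr0.ne' hconst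
    exact ⟨f r, h1, mul_right_cancel₀ hd.ne' (hr2.symm.trans h2)⟩
  obtain ⟨κ, h1, rfl⟩ := key y hy hyL
  obtain ⟨κ', h2, h3⟩ := key y⁻¹ (inv_pos.2 hy) (fun h => hyL (by simpa using hinv _ h))
  subst h3
  have h4 : (y - y⁻¹) • (u - w) = 0 := by rw [sub_smul, ← h1, ← h2, sub_self]
  rcases smul_eq_zero.1 h4 with h5 | h5
  · have h6 : y * y = 1 := by
      have : y = y⁻¹ := by linarith
      nth_rw 2 [this]
      exact mul_inv_cancel₀ hy.ne'
    have : y = 1 := by nlinarith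
    exact hyL (this ▸ hone)
  · exact hwu (sub_eq_zero.1 h5).symm
end

section
namespace Mink

open Complex (normSq)

/-- A coloring of the sphere that is not constant off a point splits the sphere into two
saturated parts, each with at least two points. -/
lemma exists_saturated_split {β : Type*} {χ : Option ℂ → β}
    (hχ : ∀ o T, ∃ o', o' ≠ o ∧ χ o' ≠ T) :
    ∃ S : Set ℂ, (∀ z ∈ S, χ (some z) ≠ χ none) ∧
      (∀ z ∈ S, ∀ w ∉ S, χ (some z) ≠ χ (some w)) ∧
      (∃ u ∈ S, ∃ n ∈ S, u ≠ n) ∧ ∃ w, w ∉ S := by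
  have key : ∃ Q : Option ℂ → Prop, (∀ o o', Q o → ¬ Q o' → χ o ≠ χ o') ∧
      (∃ u n, u ≠ n ∧ Q u ∧ Q n) ∧ ∃ u n, u ≠ n ∧ ¬ Q u ∧ ¬ Q n := by
    by_cases h : ∃ o o', o ≠ o' ∧ χ o = χ o'
    · obtain ⟨o, o', hne, heq⟩ := h
      obtain ⟨o₁, -, h₁⟩ := hχ o (χ o)
      obtain ⟨o₂, hne₂, h₂⟩ := hχ o₁ (χ o)
      exact ⟨fun x => χ x = χ o, fun x y hx hy hxy => hy (hxy.symm.trans hx),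
        ⟨o, o', hne, rfl, heq.symm⟩,
        ⟨o₁, o₂, hne₂.symm, h₁, h₂⟩⟩
    · push Not at h
      refine ⟨fun x => x = some 0 ∨ x = some 1, fun x y hx hy hxy => ?_,
        ⟨some 0, some 1, by simp, by simp, by simp⟩, ⟨none, some 2, by simp, by simp, by simp⟩⟩
      exact h x y (by rintro rfl; exact hy hx) hxy
  have key' : ∃ Q : Option ℂ → Prop, ¬ Q none ∧ (∀ o o', Q o → ¬ Q o' → χ o ≠ χ o') ∧
      (∃ u n, u ≠ n ∧ Q u ∧ Q n) ∧ ∃ u n, u ≠ n ∧ ¬ Q u ∧ ¬ Q n := by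
    obtain ⟨Q, h1, h2, h3⟩ := key
    by_cases hQ : Q none
    · exact ⟨fun o => ¬ Q o, by simpa, fun o o' ho ho' h => h1 o' o (by simpa using ho') ho h.symm,
        h3, by simpa using h2⟩
    · exact ⟨Q, hQ, h1, h2, h3⟩
  obtain ⟨Q, hnone, h1, ⟨u, n, hun, hu, hn⟩, ⟨w, w', hww, hw, hw'⟩⟩ := key'
  refine ⟨{z | Q (some z)}, fun z hz => h1 _ _ hz hnone, fun z hz w hw => h1 _ _ hz hw, ?_, ?_⟩
  · cases u with
    | none => exact absurd hu hnone
    | some u =>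
      cases n with
      | none => exact absurd hn hnone
      | some n => exact ⟨u, hu, n, hn, by simpa using hun⟩
  · cases w with
    | some w => exact ⟨w, hw⟩
    | none =>
      cases w' with
      | some w' => exact ⟨w', hw'⟩
      | none => exact absurd rfl hww

/-- A set of vectors closed under completing lightlike steps, for a coloring of null directions
that is not constant off a point, is everything once it contains a lightlike pair. -/
lemma eq_univ_of_lightlike_closed {β : Type*} {χ : Option ℂ → β}
    (hχ : ∀ o T, ∃ o', o' ≠ o ∧ χ o' ≠ T) {C : Set Mink}
    (hC : ∀ o o', χ o ≠ χ o' → ∀ b ∈ C, ∀ b' ∈ C, ∀ k : ℝ,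
      ip (dir o') (b + k • dir o) = ip (dir o') b' → b + k • dir o ∈ C)
    {b₀ b₁ : Mink} (h₀ : b₀ ∈ C) (h₁ : b₁ ∈ C) (hne : b₀ ≠ b₁)
    (hnull : ip (b₁ - b₀) (b₁ - b₀) = 0) : C = Set.univ := by
  obtain ⟨S, hSn, hSw, ⟨u, hu, n, hn, hun⟩, ⟨w, hw⟩⟩ := exists_saturated_split hχ
  have hpos : ∀ z ∈ S, ∀ w ∉ S, 0 < normSq (w - z) := fun z hz w hw =>
    Complex.normSq_pos.2 (sub_ne_zero.2 fun h => hw (h ▸ hz))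
  have ipn : ∀ (b : Mink) (k : ℝ) (z : ℂ),
      ip (dir none) (b + k • dir (some z)) = ip (dir none) b + k := by
    intro b k z
    rw [ip_add_right, ip_smul_right, ip_dir_none (dir _)]; simp [dir]
  have ips : ∀ (b : Mink) (k : ℝ) (z w : ℂ),
      ip (dir (some w)) (b + k • dir (some z)) = ip (dir (some w)) b + k * normSq (w - z) := by
    intro b k z w
    rw [ip_add_right, ip_smul_right, ip_dir_some_some]
  set B : Option ℂ → Set ℝ := fun o => (fun b => ip (dir o) b) '' C with hB
  have memn : ∀ z ∈ S, ∀ b ∈ C, ∀ k : ℝ,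
      b + k • dir (some z) ∈ C ↔ ip (dir none) b + k ∈ B none := by
    intro z hz b hb k
    constructor
    · intro h; exact ⟨_, h, ipn b k z⟩
    · rintro ⟨b', hb', h⟩
      exact hC _ none (hSn z hz) b hb b' hb' k (by rw [ipn]; exact h.symm)
  have mems : ∀ z ∈ S, ∀ w ∉ S, ∀ b ∈ C, ∀ k : ℝ,
      b + k • dir (some z) ∈ C ↔ ip (dir (some w)) b + k * normSq (w - z) ∈ B (some w) := by
    intro z hz w hw b hb k
    constructor
    · intro h; exact ⟨_, h, ips b k z w⟩
    · rintro ⟨b', hb', h⟩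
      exact hC _ (some w) (hSw z hz w hw) b hb b' hb' k (by rw [ips]; exact h.symm)
  have hL : ∀ y : ℝ, 0 < y → y ∈ {l : ℝ | 0 < l ∧ ∀ b ∈ C, ∀ k : ℝ,
      ip (dir none) b + k ∈ B none ↔ ip (dir none) b + l * k ∈ B none} := by
    intro y hy
    refine pos_mem_of_ratio_mem (S := S) ?_ ?_ ?_ hu hn hun hw hy
    · rintro x ⟨hx, hx'⟩ y ⟨hy, hy'⟩
      refine ⟨mul_pos hx hy, fun b hb k => ?_⟩
      rw [hy' b hb, hx' b hb, mul_assoc]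
    · rintro x ⟨hx, hx'⟩
      refine ⟨inv_pos.2 hx, fun b hb k => ?_⟩
      rw [hx' b hb (x⁻¹ * k), mul_inv_cancel_left₀ hx.ne']
    · intro w hw z hz u hu
      have h1 := hpos z hz w hw
      have h2 := hpos u hu w hw
      refine ⟨div_pos h1 h2, fun b hb k => ?_⟩
      rw [← memn z hz b hb, ← memn u hu b hb, mems z hz w hw b hb, mems u hu w hw b hb]
      have : normSq (w - z) / normSq (w - u) * k * normSq (w - u) = k * normSq (w - z) := by
        field_simp
      rw [this]
  have htwo : ∃ b ∈ C, ∃ b' ∈ C, ip (dir none) b ≠ ip (dir none) b' := by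
    obtain ⟨k, o, hk⟩ := exists_smul_dir hnull
    have hk0 : k ≠ 0 := by
      rintro rfl
      rw [zero_smul, sub_eq_zero] at hk
      exact hne hk.symm
    have hb₁ : b₁ = b₀ + k • dir o := by rw [← hk]; abel
    cases o with
    | some z =>
      refine ⟨b₀, h₀, b₁, h₁, ?_⟩
      rw [hb₁, ipn]
      simpa using hk0
    | none =>
      have h2 := hpos u hu w hw
      refine ⟨b₀, h₀, b₀ + (k / normSq (w - u)) • dir (some u), ?_, ?_⟩
      · rw [mems u hu w hw b₀ h₀]
        refine ⟨b₁, h₁, ?_⟩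
        simp only
        rw [hb₁, ip_add_right, ip_smul_right, div_mul_cancel₀ _ h2.ne']
        rw [ip_comm (dir (some w)) (dir none), ip_dir_none]
        simp [dir]
      · rw [ipn]
        have : k / normSq (w - u) ≠ 0 := div_ne_zero hk0 h2.ne'
        simpa using this
  have hBn : ∀ x, x ∈ B none := by
    intro x
    obtain ⟨b, hb, b', hb', hbb⟩ := htwo
    set α := ip (dir none) b
    set β := ip (dir none) b'
    have hαβ : β - α ≠ 0 := sub_ne_zero.2 hbb.symm
    rcases lt_or_ge 0 ((x - α) / (β - α)) with h | h
    · have := ((hL _ h).2 b hb (β - α)).1 ⟨b', hb', by simp [α, β]⟩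
      rwa [div_mul_cancel₀ _ hαβ, add_sub_cancel] at this
    · have h' : 0 < (x - β) / (α - β) := by
        have : (x - β) / (α - β) = 1 - (x - α) / (β - α) := by
          have : α - β ≠ 0 := sub_ne_zero.2 hbb
          field_simp
          ring
        linarith
      have := ((hL _ h').2 b' hb' (α - β)).1 ⟨b, hb, by simp [α, β]⟩
      rwa [div_mul_cancel₀ _ (sub_ne_zero.2 hbb), add_sub_cancel] at this
  have stepS : ∀ z ∈ S, ∀ b ∈ C, ∀ k : ℝ, b + k • dir (some z) ∈ C := fun z hz b hb k =>
    (memn z hz b hb k).2 (hBn _)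
  have hBu : ∀ x, ∃ b ∈ C, ip (dir (some u)) b = x := by
    intro x
    have h2 : normSq (u - n) ≠ 0 := (Complex.normSq_pos.2 (sub_ne_zero.2 hun)).ne'
    refine ⟨_, stepS n hn b₀ h₀ ((x - ip (dir (some u)) b₀) / normSq (u - n)), ?_⟩
    rw [ips, div_mul_cancel₀ _ h2]; ring
  have step : ∀ o, ∀ b ∈ C, ∀ k : ℝ, b + k • dir o ∈ C := by
    intro o b hb k
    obtain ⟨b', hb', h⟩ := hBu (ip (dir (some u)) (b + k • dir o))
    cases o with
    | none => exact hC none (some u) (hSn u hu).symm b hb b' hb' k h.symm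
    | some z =>
      by_cases hz : z ∈ S
      · exact stepS z hz b hb k
      · exact hC (some z) (some u) (hSw u hu z hz).symm b hb b' hb' k h.symm
  refine Set.eq_univ_of_forall fun A => ?_
  obtain ⟨x, y, z, t, h⟩ := eq_sum_dir (A - b₀)
  rw [sub_eq_iff_eq_add'] at h
  rw [h, ← add_assoc, ← add_assoc, ← add_assoc]
  exact step _ _ (step _ _ (step _ _ (step _ _ h₀ x) y) z) t

end Mink
end

section

open Mink

/-- A description of a point geometry with coherency relation `R` as the conformal compactification
of Minkowski space, with the vertex of the light cone at infinity placed at `x`. -/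
structure MinkChart {P : Type*} (R : P → P → Prop) (x : P) where
  /-- The points not coherent with `x`. -/
  aff : Mink → P
  /-- The points coherent with `x` and different from it. -/
  inf : Option ℂ → ℝ → P
  not_base_aff : ∀ A, ¬ R x (aff A)
  base_inf : ∀ o k, R x (inf o k)
  base_ne_inf : ∀ o k, x ≠ inf o k
  aff_aff : ∀ A B, R (aff A) (aff B) ↔ ip (A - B) (A - B) = 0
  aff_inf : ∀ A o k, R (aff A) (inf o k) ↔ ip (dir o) A = k
  inf_inf : ∀ o k o' k', R (inf o k) (inf o' k') ↔ o = o'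
  exhaust : ∀ p, p = x ∨ (∃ A, p = aff A) ∨ ∃ o k, p = inf o k

/-- A reflexive symmetric relation which looks like compactified Minkowski space from each point. -/
structure IsMinkGeom {P : Type*} (R : P → P → Prop) : Prop where
  refl : ∀ p, R p p
  symm : ∀ {p q}, R p q → R q p
  chart : ∀ x, Nonempty (MinkChart R x)

namespace MinkChart

variable {P : Type*} {R : P → P → Prop} {x : P}

lemma exists_aff (c : MinkChart R x) (hR : IsMinkGeom R) {p : P} (h : ¬ R x p) :
    ∃ A, p = c.aff A := by
  rcases c.exhaust p with rfl | h' | ⟨o, k, rfl⟩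
  · exact absurd (hR.refl _) h
  · exact h'
  · exact absurd (c.base_inf o k) h

lemma exists_inf (c : MinkChart R x) {p : P} (h : R x p) (hne : x ≠ p) :
    ∃ o k, p = c.inf o k := by
  rcases c.exhaust p with rfl | ⟨A, rfl⟩ | h'
  · exact absurd rfl hne
  · exact absurd h (c.not_base_aff A)
  · exact h'

end MinkChart

namespace IsMinkGeom

variable {P : Type*} {R : P → P → Prop}

lemma ne_of_not (hR : IsMinkGeom R) {p q : P} (h : ¬ R p q) : p ≠ q := fun e => h (e ▸ hR.refl p)

lemma not_symm (hR : IsMinkGeom R) {p q : P} (h : ¬ R p q) : ¬ R q p := fun e => h (hR.symm e)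

/-- Two distinct coherent points span a clique. -/
lemma line (hR : IsMinkGeom R) {u v r s : P} (hne : u ≠ v) (huv : R u v) (hru : R r u)
    (hrv : R r v) (hsu : R s u) (hsv : R s v) : R r s := by
  obtain ⟨c⟩ := hR.chart u
  obtain ⟨o, k, rfl⟩ := c.exists_inf huv hne
  by_cases hr : u = r
  · subst hr; exact hR.symm hsu
  by_cases hs : u = s
  · subst hs; exact hru
  obtain ⟨o₁, k₁, rfl⟩ := c.exists_inf (hR.symm hru) hr
  obtain ⟨o₂, k₂, rfl⟩ := c.exists_inf (hR.symm hsu) hs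
  rw [c.inf_inf] at *
  rw [hrv, hsv]

/-- Every point is coherent with some point of a given line. -/
lemma exists_on_line (hR : IsMinkGeom R) {u v : P} (hne : u ≠ v) (huv : R u v) (p : P) :
    ∃ y, R y u ∧ R y v ∧ R y p := by
  obtain ⟨c⟩ := hR.chart u
  obtain ⟨o, k, rfl⟩ := c.exists_inf huv hne
  rcases c.exhaust p with rfl | ⟨A, rfl⟩ | ⟨o', k', rfl⟩
  · exact ⟨p, hR.refl _, huv, hR.refl _⟩
  · exact ⟨c.inf o (ip (dir o) A), hR.symm (c.base_inf _ _), (c.inf_inf _ _ _ _).2 rfl,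
      hR.symm ((c.aff_inf _ _ _).2 rfl)⟩
  · exact ⟨u, hR.refl _, huv, c.base_inf _ _⟩

/-- Common neighbours of two opposite points form a coclique. -/
lemma eq_of_common (hR : IsMinkGeom R) {c d p q : P} (h : ¬ R c d) (hpc : R p c) (hpd : R p d)
    (hqc : R q c) (hqd : R q d) (hpq : R p q) : p = q := by
  by_contra hne
  exact h (hR.line hne hpq (hR.symm hpc) (hR.symm hqc) (hR.symm hpd) (hR.symm hqd))

lemma exists_common_not (hR : IsMinkGeom R) {x p q : P} (h : ¬ R x p) (hqx : q ≠ x) (hqp : q ≠ p) :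
    ∃ y, R y x ∧ R y p ∧ ¬ R y q := by
  obtain ⟨c⟩ := hR.chart x
  obtain ⟨A, rfl⟩ := c.exists_aff hR h
  rcases c.exhaust q with rfl | ⟨B, rfl⟩ | ⟨o, k, rfl⟩
  · exact absurd rfl hqx
  · obtain ⟨o, ho⟩ := exists_dir_ip_ne_zero (A := B - A)
      (sub_ne_zero.2 fun h => hqp (by rw [h]))
    refine ⟨c.inf o (ip (dir o) A), hR.symm (c.base_inf _ _), hR.symm ((c.aff_inf _ _ _).2 rfl),
      fun hy => ho ?_⟩
    have := (c.aff_inf _ _ _).1 (hR.symm hy)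
    rw [ip_sub_right, this, sub_self]
  · obtain ⟨o', ho'⟩ := exists_ne o
    exact ⟨c.inf o' (ip (dir o') A), hR.symm (c.base_inf _ _), hR.symm ((c.aff_inf _ _ _).2 rfl),
      fun hy => ho' ((c.inf_inf _ _ _ _).1 hy)⟩

/-- Opposite points have three pairwise opposite common neighbours. -/
lemma exists_three_common (hR : IsMinkGeom R) {a g : P} (h : ¬ R a g) :
    ∃ p : Fin 3 → P, (∀ i, R (p i) a ∧ R (p i) g) ∧ ∀ i j, i ≠ j → ¬ R (p i) (p j) := by
  obtain ⟨c⟩ := hR.chart a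
  obtain ⟨A, rfl⟩ := c.exists_aff hR h
  have key : ∀ o : Fin 3 → Option ℂ, Function.Injective o →
      ∃ p : Fin 3 → P, (∀ i, R (p i) a ∧ R (p i) (c.aff A)) ∧ ∀ i j, i ≠ j → ¬ R (p i) (p j) :=
    fun o ho => ⟨fun i => c.inf (o i) (ip (dir (o i)) A), fun i => ⟨hR.symm (c.base_inf _ _),
      hR.symm ((c.aff_inf _ _ _).2 rfl)⟩, fun i j hij hr => hij (ho ((c.inf_inf _ _ _ _).1 hr))⟩
  refine key (fun i => some (i : ℕ)) fun i j hij => ?_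
  simpa [Fin.ext_iff] using hij

lemma exists_opposite_both (hR : IsMinkGeom R) (x q : P) : ∃ r, ¬ R x r ∧ ¬ R q r := by
  obtain ⟨c⟩ := hR.chart x
  rcases c.exhaust q with rfl | ⟨A, rfl⟩ | ⟨o, k, rfl⟩
  · exact ⟨c.aff 0, c.not_base_aff _, c.not_base_aff _⟩
  · refine ⟨c.aff (A - (1, 1, 0)), c.not_base_aff _, ?_⟩
    rw [c.aff_aff, sub_sub_cancel]
    simp [ip]
  · obtain ⟨o', ho'⟩ := exists_ne o
    have h0 := ip_dir_ne_zero ho'.symm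
    refine ⟨c.aff (((k + 1) / ip (dir o) (dir o')) • dir o'), c.not_base_aff _, fun h => ?_⟩
    have := (c.aff_inf _ _ _).1 (hR.symm h)
    rw [ip_smul_right, div_mul_cancel₀ _ h0] at this
    linarith

lemma exists_coherent_not (hR : IsMinkGeom R) {p q : P} (h : p ≠ q) : ∃ r, R r p ∧ ¬ R r q := by
  by_cases hpq : R p q
  · obtain ⟨c⟩ := hR.chart p
    obtain ⟨o, k, rfl⟩ := c.exists_inf hpq h
    obtain ⟨o', ho'⟩ := exists_ne o
    exact ⟨c.inf o' 0, hR.symm (c.base_inf _ _), fun hy => ho' ((c.inf_inf _ _ _ _).1 hy)⟩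
  · exact ⟨p, hR.refl _, hpq⟩

/-- Three pairwise opposite neighbours of `a` have a common neighbour opposite to `a`. -/
lemma exists_common_three (hR : IsMinkGeom R) {a x r r' : P} (hxa : R x a) (hr : R r a)
    (hr' : R r' a) (hrx : ¬ R r x) (hrx' : ¬ R r' x) (hrr : ¬ R r r') :
    ∃ s, R s x ∧ ¬ R s a ∧ R s r ∧ R s r' := by
  obtain ⟨c⟩ := hR.chart a
  obtain ⟨m, i, rfl⟩ := c.exists_inf (hR.symm hxa) (by rintro rfl; exact hrx hr)
  obtain ⟨n, j, rfl⟩ := c.exists_inf (hR.symm hr) (by rintro rfl; exact hrx (hR.symm hxa))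
  obtain ⟨n', k, rfl⟩ := c.exists_inf (hR.symm hr') (by rintro rfl; exact hrx' (hR.symm hxa))
  rw [c.inf_inf] at *
  have h1 := ip_dir_ne_zero hrx
  have h2 := ip_dir_ne_zero hrx'
  have h3 := ip_dir_ne_zero hrr
  have h4 := ip_comm (dir m) (dir n)
  have h5 := ip_comm (dir m) (dir n')
  have h6 := ip_comm (dir n') (dir n)
  generalize hp : ip (dir n) (dir m) = p at h1 h4
  generalize hq : ip (dir n') (dir m) = q at h2 h5
  generalize ht : ip (dir n) (dir n') = t at h3 h6
  refine ⟨c.aff (((j * q + k * p - i * t) / (2 * p * q)) • dir m +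
    ((i * t + k * p - j * q) / (2 * p * t)) • dir n +
    ((i * t + j * q - k * p) / (2 * q * t)) • dir n'), ?_, fun h => c.not_base_aff _ (hR.symm h),
    ?_, ?_⟩ <;> rw [c.aff_inf] <;>
    simp only [ip_add_right, ip_smul_right, ip_dir_self, h4, h5, h6, hp, hq, ht] <;>
    field_simp <;> ring

end IsMinkGeom
end

section

/-- A self-map is degenerate if, off a point, its image lies in a cone with vertex in the range,
or, off a line, its image lies in a line. -/
def IsDegenerate {P : Type*} (R : P → P → Prop) (Φ : P → P) : Prop :=
  (∃ A, ∃ B ∈ Set.range Φ, ∀ U, U ≠ A → R (Φ U) B) ∨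
  ∃ u v u' v', u ≠ v ∧ R u v ∧ u' ≠ v' ∧ R u' v' ∧
    ∀ w, ¬ (R w u ∧ R w v) → R (Φ w) u' ∧ R (Φ w) v'

lemma exists_not_and_not_of_fin_three {A B : Fin 3 → Prop} (hA : ∀ i j, i ≠ j → A i → ¬ A j)
    (hB : ∀ i j, i ≠ j → B i → ¬ B j) : ∃ i, ¬ A i ∧ ¬ B i := by
  have h01 := hA 0 1 (by decide)
  have h02 := hA 0 2 (by decide)
  have h12 := hA 1 2 (by decide)
  have k01 := hB 0 1 (by decide)
  have k02 := hB 0 2 (by decide)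
  have k12 := hB 1 2 (by decide)
  by_contra! h
  have h0 := h 0
  have h1 := h 1
  have h2 := h 2
  tauto

namespace IsMinkGeom

variable {P : Type*} {R : P → P → Prop} {Φ : P → P}

/-- The configuration in which two opposite points `a`, `z` with common neighbour `t` have the
neighbours not coherent with `t` mapped into two lines meeting in `e`. -/
structure Fork (R : P → P → Prop) (Φ : P → P) (a z t e k h : P) : Prop where
  not_az : ¬ R a z
  ta : R t a
  tz : R t z
  ek : R e k
  eh : R e h
  not_kh : ¬ R k h
  map_a : ∀ p, R p a → ¬ R p t → R (Φ p) e ∧ R (Φ p) k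
  map_z : ∀ p, R p z → ¬ R p t → R (Φ p) e ∧ R (Φ p) h

namespace Fork

variable {a z t e k h : P}

lemma swap (hR : IsMinkGeom R) (F : Fork R Φ a z t e k h) : Fork R Φ z a t e h k :=
  ⟨hR.not_symm F.not_az, F.tz, F.ta, F.eh, F.ek, hR.not_symm F.not_kh, F.map_z, F.map_a⟩

lemma t_ne_a (F : Fork R Φ a z t e k h) : t ≠ a := by
  rintro rfl; exact F.not_az F.tz

lemma t_ne_z (hR : IsMinkGeom R) (F : Fork R Φ a z t e k h) : t ≠ z := by
  rintro rfl; exact F.not_az (hR.symm F.ta)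

lemma e_ne_h (F : Fork R Φ a z t e k h) (hR : IsMinkGeom R) : e ≠ h := by
  rintro rfl; exact F.not_kh (hR.symm F.ek)

lemma map_common (hR : IsMinkGeom R) (F : Fork R Φ a z t e k h) {y : P} (hya : R y a)
    (hyz : R y z) (hyt : ¬ R y t) : Φ y = e :=
  hR.eq_of_common F.not_kh (F.map_a y hya hyt).2 (F.map_z y hyz hyt).2 F.ek F.eh
    (F.map_a y hya hyt).1

lemma exists_common (hR : IsMinkGeom R) (F : Fork R Φ a z t e k h) :
    ∃ y, R y a ∧ R y z ∧ ¬ R y t ∧ Φ y = e := by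
  obtain ⟨y, h1, h2, h3⟩ := hR.exists_common_not F.not_az F.t_ne_a (F.t_ne_z hR)
  exact ⟨y, h1, h2, h3, F.map_common hR h1 h2 h3⟩

lemma map_coherent (hR : IsMinkGeom R) (hΦ : ∀ p q, R p q → R (Φ p) (Φ q))
    (F : Fork R Φ a z t e k h) {g : P} (hga : ¬ R g a) (hgz : ¬ R g z) : R (Φ g) e := by
  obtain ⟨p, hp, hpp⟩ := hR.exists_three_common (hR.not_symm hga)
  have hq : ∀ i, ∃ q, R q g ∧ R q (p i) ∧ R q z := fun i =>
    hR.exists_on_line (by intro e; exact hga (e ▸ (hp i).1)) (hR.symm (hp i).2) z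
  choose q hqg hqp hqz using hq
  have hgood : ∃ i, ¬ R (p i) t ∧ ¬ R (q i) t := by
    refine exists_not_and_not_of_fin_three (fun i j hij hi hj => hpp i j hij ?_)
      fun i j hij hi hj => hpp i j hij ?_
    · exact hR.line F.t_ne_a F.ta hi (hp i).1 hj (hp j).1
    · have hqq : R (q i) (q j) := hR.line (F.t_ne_z hR) F.tz hi (hqz i) hj (hqz j)
      have heq : q i = q j := hR.eq_of_common hgz (hqg i) (hqz i) (hqg j) (hqz j) hqq
      have hne : g ≠ q i := by intro e; exact hgz (e ▸ hqz i)
      exact hR.line hne (hR.symm (hqg i)) (hp i).2 (hR.symm (hqp i)) (hp j).2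
        (heq ▸ hR.symm (hqp j))
  obtain ⟨i, hpt, hqt⟩ := hgood
  obtain ⟨h1, h2⟩ := F.map_a _ (hp i).1 hpt
  obtain ⟨h3, h4⟩ := F.map_z _ (hqz i) hqt
  have h5 := hΦ _ _ (hqp i)
  by_cases hpe : Φ (p i) = e
  · rw [← hpe]; exact hΦ _ _ (hR.symm (hp i).2)
  by_cases hqe : Φ (q i) = e
  · rw [← hqe]; exact hΦ _ _ (hR.symm (hqg i))
  have h6 : R k (Φ (q i)) := hR.line hpe h1 (hR.symm h2) (hR.symm F.ek) h5 h3
  exact absurd (hR.line hqe h3 h6 (hR.symm F.ek) (hR.symm h4) (hR.symm F.eh)) F.not_kh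

lemma degenerate_of_exceptional (hR : IsMinkGeom R) (hΦ : ∀ p q, R p q → R (Φ p) (Φ q))
    (F : Fork R Φ a z t e k h) {x : P} (hxe : ¬ R (Φ x) e) (hxa : R x a) (hxt : R x t)
    (hne : x ≠ t) : IsDegenerate R Φ := by
  obtain ⟨y, hya, hyz, hyt, hye⟩ := F.exists_common hR
  have hax : a ≠ x := by
    rintro rfl; exact hxe (hye ▸ hΦ _ _ (hR.symm hya))
  have hxz : ¬ R x z := fun hxz => hne (hR.eq_of_common F.not_az hxa hxz F.ta F.tz hxt)
  obtain ⟨f, hfe, hfh, hfx⟩ := hR.exists_on_line (F.e_ne_h hR) F.eh (Φ x)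
  have hef : e ≠ f := by rintro rfl; exact hxe (hR.symm hfx)
  have hfk : ¬ R f k := fun hfk => F.not_kh
    (hR.line hef (hR.symm hfe) (hR.symm F.ek) (hR.symm hfk) (hR.symm F.eh) (hR.symm hfh))
  have line_at : ∀ {p}, R p a → R p x → R p t := fun h1 h2 =>
    hR.line hax (hR.symm hxa) h1 h2 F.ta (hR.symm hxt)
  have line_ax : ∀ {p}, R p a → R p t → R p x := fun h1 h2 =>
    hR.line F.t_ne_a F.ta h2 h1 hxt hxa
  have map_xz : ∀ y, R y x → R y z → ¬ R y t → Φ y = f := by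
    intro y h1 h2 h3
    obtain ⟨h4, h5⟩ := F.map_z y h2 h3
    exact hR.eq_of_common hxe (hΦ _ _ h1) h4 hfx hfe
      (hR.line (F.e_ne_h hR) F.eh h4 h5 hfe hfh)
  have map_x : ∀ p, R p x → ¬ R p a → R (Φ p) f := by
    intro p hpx hpa
    have hxp : x ≠ p := by rintro rfl; exact hpa hxa
    obtain ⟨y, h1, h2, h3⟩ := hR.exists_on_line hxp (hR.symm hpx) z
    have h4 : ¬ R y t := by
      intro h4
      have : y = t := hR.eq_of_common hxz h1 h3 (hR.symm hxt) F.tz h4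
      subst this
      exact hpa (hR.line hne hxt hpx (hR.symm h2) (hR.symm hxa) (hR.symm F.ta))
    rw [← map_xz y h1 h3 h4]
    exact hΦ _ _ (hR.symm h2)
  have map_a' : ∀ r, R r a → ¬ R r x → Φ r = e := by
    intro r hra hrx
    have hrt : ¬ R r t := fun h => hrx (line_ax hra h)
    have har : a ≠ r := by rintro rfl; exact hrx (hR.symm hxa)
    obtain ⟨q, hq, hqq⟩ := hR.exists_three_common F.not_az
    obtain ⟨i, hit, hir⟩ : ∃ i, ¬ R (q i) t ∧ ¬ R (q i) r :=
      exists_not_and_not_of_fin_three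
        (fun i j hij hi hj => hqq i j hij (hR.line F.t_ne_a F.ta hi (hq i).1 hj (hq j).1))
        fun i j hij hi hj => hqq i j hij (hR.line har (hR.symm hra) (hq i).1 hi (hq j).1 hj)
    have hix : ¬ R (q i) x := fun h => hit (line_at (hq i).1 h)
    obtain ⟨s, hsx, hsa, hsr, hsq⟩ :=
      hR.exists_common_three hxa hra (hq i).1 hrx hix (hR.not_symm hir)
    have hse : R (Φ s) e := by
      rw [← F.map_common hR (hq i).1 (hq i).2 hit]; exact hΦ _ _ hsq
    have hsf : Φ s = f := hR.eq_of_common hxe (hΦ _ _ hsx) hse hfx hfe (map_x s hsx hsa)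
    have hrf : R f (Φ r) := hsf ▸ hΦ _ _ hsr
    obtain ⟨h1, h2⟩ := F.map_a r hra hrt
    by_contra hre
    exact hfk (hR.line hre h1 hrf hfe (hR.symm h2) (hR.symm F.ek))
  have map_x' : ∀ p, R p x → ¬ R p a → Φ p = f := by
    intro p hpx hpa
    obtain ⟨r, h1, h2, h3⟩ := hR.exists_on_line (u := a) (v := y)
      (by rintro rfl; exact hyt (hR.symm F.ta)) (hR.symm hya) p
    have har : a ≠ r := by rintro rfl; exact hpa (hR.symm h3)
    have hrx : ¬ R r x := fun hrx => hyt
      (line_at hya (hR.line har (hR.symm h1) hya (hR.symm h2) hxa (hR.symm hrx)))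
    have hpe : R (Φ p) e := by
      rw [← map_a' r h1 hrx]; exact hΦ _ _ (hR.symm h3)
    exact hR.eq_of_common hxe (hΦ _ _ hpx) hpe hfx hfe (map_x p hpx hpa)
  refine Or.inr ⟨a, t, e, h, F.t_ne_a.symm, hR.symm F.ta, F.e_ne_h hR, F.eh, fun w hw => ?_⟩
  by_cases hwa : R w a
  · rw [map_a' w hwa fun h => hw ⟨hwa, line_at hwa h⟩]
    exact ⟨hR.refl _, F.eh⟩
  by_cases hwx : R w x
  · rw [map_x' w hwx hwa]
    exact ⟨hfe, hfh⟩
  obtain ⟨r, hrw, hra, hrx⟩ := hR.exists_common_not hwa (hR.ne_of_not hwx).symm hax.symm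
  obtain ⟨p, hpw, hpx, hpa⟩ := hR.exists_common_not hwx (hR.ne_of_not hwa).symm hax
  have h1 : R (Φ w) e := by rw [← map_a' r hra hrx]; exact hΦ _ _ (hR.symm hrw)
  have h2 : R (Φ w) f := by rw [← map_x' p hpx hpa]; exact hΦ _ _ (hR.symm hpw)
  exact ⟨h1, hR.line hef (hR.symm hfe) h1 h2 (hR.symm F.eh) (hR.symm hfh)⟩

lemma degenerate (hR : IsMinkGeom R) (hΦ : ∀ p q, R p q → R (Φ p) (Φ q))
    (F : Fork R Φ a z t e k h) : IsDegenerate R Φ := by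
  by_cases hex : ∃ x, ¬ R (Φ x) e ∧ x ≠ t
  · obtain ⟨x, hxe, hne⟩ := hex
    by_cases hxa : R x a
    · by_cases hxt : R x t
      · exact F.degenerate_of_exceptional hR hΦ hxe hxa hxt hne
      · exact absurd (F.map_a x hxa hxt).1 hxe
    by_cases hxz : R x z
    · by_cases hxt : R x t
      · exact (F.swap hR).degenerate_of_exceptional hR hΦ hxe hxz hxt hne
      · exact absurd (F.map_z x hxz hxt).1 hxe
    exact absurd (F.map_coherent hR hΦ hxa hxz) hxe
  · push Not at hex
    obtain ⟨y, -, -, -, hy⟩ := F.exists_common hR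
    refine Or.inl ⟨t, e, ⟨y, hy⟩, fun U hU => ?_⟩
    by_contra hUe
    exact hU (hex U hUe)

end Fork

/-- A coherency preserver mapping the neighbours of a point that are off some line through it into a
line is degenerate. -/
lemma degenerate_of_map_cone (hR : IsMinkGeom R) (hΦ : ∀ p q, R p q → R (Φ p) (Φ q))
    {a l k₁ k₂ : P} (hal : a ≠ l) (ral : R a l) (hk : k₁ ≠ k₂) (rk : R k₁ k₂)
    (hmap : ∀ p, R p a → ¬ R p l → R (Φ p) k₁ ∧ R (Φ p) k₂) : IsDegenerate R Φ := by
  by_cases hall : ∀ w, ¬ (R w a ∧ R w l) → R (Φ w) k₁ ∧ R (Φ w) k₂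
  · exact Or.inr ⟨a, l, k₁, k₂, hal, ral, hk, rk, hall⟩
  push Not at hall
  obtain ⟨z, hz, hzk⟩ := hall
  have hza : ¬ R z a := fun h => hzk (hmap z h (hz h)).1 (hmap z h (hz h)).2
  obtain ⟨t, hta, htl, htz⟩ := hR.exists_on_line hal ral z
  obtain ⟨e, he₁, he₂, hez⟩ := hR.exists_on_line hk rk (Φ z)
  obtain ⟨k, hk₁, hk₂, hke⟩ : ∃ k, R k k₁ ∧ R k k₂ ∧ k ≠ e := by
    by_cases h : k₁ = e
    · exact ⟨k₂, hR.symm rk, hR.refl _, fun h' => hk (h.trans h'.symm)⟩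
    · exact ⟨k₁, hR.refl _, rk, h⟩
  have rke : R k e := hR.line hk rk hk₁ hk₂ he₁ he₂
  have hkz : ¬ R k (Φ z) := fun h => hzk
    (hR.line hke rke (hR.symm h) (hR.symm hez) (hR.symm hk₁) (hR.symm he₁))
    (hR.line hke rke (hR.symm h) (hR.symm hez) (hR.symm hk₂) (hR.symm he₂))
  have map_a : ∀ p, R p a → ¬ R p t → R (Φ p) e ∧ R (Φ p) k := by
    intro p hpa hpt
    obtain ⟨h1, h2⟩ := hmap p hpa fun hpl => hpt (hR.line hal ral hpa hpl hta htl)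
    exact ⟨hR.line hk rk h1 h2 he₁ he₂, hR.line hk rk h1 h2 hk₁ hk₂⟩
  refine Fork.degenerate hR hΦ (a := a) (z := z) (t := t) (e := e) (k := k) (h := Φ z)
    ⟨hR.not_symm hza, hta, htz, hR.symm rke, hez, hkz, map_a, fun p hpz hpt => ?_⟩
  have hzp : z ≠ p := by rintro rfl; exact hpt (hR.symm htz)
  obtain ⟨y, hyz, hyp, hya⟩ := hR.exists_on_line hzp (hR.symm hpz) a
  have hyt : ¬ R y t := by
    intro hyt
    have : y = t := hR.eq_of_common hza hyz hya htz hta hyt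
    exact hpt (this ▸ hR.symm hyp)
  obtain ⟨h1, h2⟩ := map_a y hya hyt
  have hye : Φ y = e := by
    by_contra hye
    exact hkz (hR.line hye h1 (hR.symm h2) rke (hΦ _ _ (hR.symm hyz)) (hR.symm hez))
  exact ⟨hye ▸ hΦ _ _ (hR.symm hyp), hΦ _ _ hpz⟩

end IsMinkGeom
end

section

open Mink

namespace IsMinkGeom

variable {P : Type*} {R : P → P → Prop} {Φ : P → P}

/-- A coherency preserver identifying two distinct coherent points is degenerate. -/
lemma degenerate_of_map_eq (hR : IsMinkGeom R) (hΦ : ∀ p q, R p q → R (Φ p) (Φ q))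
    {a b : P} (hab : a ≠ b) (rab : R a b) (heq : Φ a = Φ b) : IsDegenerate R Φ := by
  by_cases hall : ∀ x, R (Φ x) (Φ a)
  · exact Or.inl ⟨a, Φ a, ⟨a, rfl⟩, fun U _ => hall U⟩
  push Not at hall
  obtain ⟨x, hx⟩ := hall
  obtain ⟨c⟩ := hR.chart x
  have hx' : ∀ {p}, Φ p = Φ a → ¬ R x p := fun hp h => hx (hp ▸ hΦ _ _ h)
  obtain ⟨b₀, hb₀⟩ := c.exists_aff hR (hx' rfl)
  obtain ⟨b₁, hb₁⟩ := c.exists_aff hR (hx' heq.symm)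
  set C : Set Mink := {A | Φ (c.aff A) = Φ a} with hC
  have h₀ : b₀ ∈ C := by rw [hC, Set.mem_ofPred_eq, ← hb₀]
  have h₁ : b₁ ∈ C := by rw [hC, Set.mem_ofPred_eq, ← hb₁, heq]
  set τ : Option ℂ → P := fun o => Φ (c.inf o (ip (dir o) b₀)) with hτ
  have map_inf : ∀ A o, R (Φ (c.inf o (ip (dir o) A))) (Φ (c.aff A)) := fun A o =>
    hΦ _ _ (hR.symm ((c.aff_inf _ _ _).2 rfl))
  have map_inf_x : ∀ o k, R (Φ (c.inf o k)) (Φ x) := fun o k =>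
    hΦ _ _ (hR.symm (c.base_inf o k))
  have hτC : ∀ o, ∀ A ∈ C, Φ (c.inf o (ip (dir o) A)) = τ o := by
    intro o A hA
    refine hR.eq_of_common hx (map_inf_x _ _) (hA ▸ map_inf A o) (map_inf_x _ _) (h₀ ▸ map_inf b₀ o)
      (hΦ _ _ ((c.inf_inf _ _ _ _).2 rfl))
  have hτc : ∀ o, R (τ o) (Φ a) := fun o => h₀ ▸ map_inf b₀ o
  by_cases hflat : ∀ o T, ∃ o', o' ≠ o ∧ τ o' ≠ T
  · have huniv : C = Set.univ := by
      refine eq_univ_of_lightlike_closed hflat ?_ h₀ h₁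
        (by rintro rfl; exact hab (hb₀.trans hb₁.symm))
        ((c.aff_aff _ _).1 (by rw [← hb₀, ← hb₁]; exact hR.symm rab))
      intro o o' hoo B hB B' hB' k hk
      have h1 : R (Φ (c.aff (B + k • dir o))) (τ o) := by
        rw [← hτC o B hB]
        refine hΦ _ _ ((c.aff_inf _ _ _).2 ?_)
        rw [ip_add_right, ip_smul_right, ip_dir_self, mul_zero, add_zero]
      have h2 : R (Φ (c.aff (B + k • dir o))) (τ o') := by
        rw [← hτC o' B' hB', ← hk]
        exact hR.symm (map_inf _ _)
      have h3 : R (Φ (c.aff (B + k • dir o))) (Φ a) := by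
        rw [← show Φ (c.aff B) = Φ a from hB]
        refine hΦ _ _ ((c.aff_aff _ _).2 ?_)
        rw [add_sub_cancel_left, ip_smul_left, ip_smul_right, ip_dir_self, mul_zero, mul_zero]
      by_contra hne
      refine hoo (hR.eq_of_common hx (map_inf_x _ _) (hτc o) (map_inf_x _ _) (hτc o') ?_)
      exact hR.line hne h3 (hR.symm h1) (hτc o) (hR.symm h2) (hτc o')
    have hC' : ∀ A, Φ (c.aff A) = Φ a := fun A => by
      have : A ∈ C := huniv ▸ Set.mem_univ A
      exact this
    refine Or.inl ⟨x, Φ a, ⟨a, rfl⟩, fun U hU => ?_⟩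
    rcases c.exhaust U with rfl | ⟨A, rfl⟩ | ⟨o, k, rfl⟩
    · exact absurd rfl hU
    · rw [hC' A]; exact hR.refl _
    · obtain ⟨o', ho'⟩ := exists_ne o
      rw [← hC' ((k / ip (dir o) (dir o')) • dir o')]
      refine hΦ _ _ (hR.symm ((c.aff_inf _ _ _).2 ?_))
      rw [ip_smul_right, div_mul_cancel₀ _ (ip_dir_ne_zero ho'.symm)]
  · push Not at hflat
    obtain ⟨o, T, hT⟩ := hflat
    obtain ⟨o₁, ho₁⟩ := exists_ne o
    have hTx : R T (Φ x) := hT o₁ ho₁ ▸ map_inf_x _ _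
    have hTa : R T (Φ a) := hT o₁ ho₁ ▸ hτc o₁
    refine hR.degenerate_of_map_cone hΦ (a := a) (l := c.inf o (ip (dir o) b₀)) (k₁ := Φ a)
      (k₂ := T) ?_ ?_ (by rintro h; exact hx (hR.symm (h ▸ hTx))) (hR.symm hTa) fun p hpa hpl => ?_
    · intro h
      exact hx' rfl (h ▸ c.base_inf _ _)
    · rw [hb₀]
      exact (c.aff_inf _ _ _).2 rfl
    · refine ⟨hΦ _ _ hpa, ?_⟩
      rcases c.exhaust p with rfl | ⟨A, rfl⟩ | ⟨o', k', rfl⟩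
      · exact absurd (c.base_inf _ _) hpl
      · rw [hb₀, c.aff_aff] at hpa
        obtain ⟨k, o', hk⟩ := exists_smul_dir hpa
        have ho' : o' ≠ o := by
          rintro rfl
          refine hpl ((c.aff_inf _ _ _).2 ?_)
          rw [← sub_eq_zero, ← ip_sub_right, hk, ip_smul_right, ip_dir_self, mul_zero]
        rw [← hT o' ho']
        refine hΦ _ _ ((c.aff_inf _ _ _).2 ?_)
        rw [← sub_eq_zero, ← ip_sub_right, hk, ip_smul_right, ip_dir_self, mul_zero]
      · have hk' : ip (dir o') b₀ = k' := by
          rw [← c.aff_inf, ← hb₀]; exact hR.symm hpa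
        rw [← hk', ← hT o' fun h => hpl ((c.inf_inf _ _ _ _).2 h)]
        exact hR.refl _

/-- A coherency preserver that is injective on lines but maps some opposite pair to a coherent
pair is degenerate. -/
lemma degenerate_of_map_coherent (hR : IsMinkGeom R) (hΦ : ∀ p q, R p q → R (Φ p) (Φ q))
    (hinj : ∀ a b, a ≠ b → R a b → Φ a ≠ Φ b) {p q : P} (hpq : ¬ R p q)
    (h : R (Φ p) (Φ q)) : IsDegenerate R Φ := by
  refine Or.inl ⟨p, Φ p, ⟨p, rfl⟩, fun x _ => ?_⟩
  have cone : ∀ {p q}, ¬ R p q → R (Φ p) (Φ q) → ∀ y, R y p → R (Φ y) (Φ q) := by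
    intro p q hpq h y hyp
    by_cases hyp' : p = y
    · exact hyp' ▸ h
    obtain ⟨z, hzp, hzy, hzq⟩ := hR.exists_on_line hyp' (hR.symm hyp) q
    have hpz : p ≠ z := by rintro rfl; exact hpq hzq
    exact hR.line (hinj p z hpz (hR.symm hzp)) (hΦ _ _ (hR.symm hzp)) (hΦ _ _ hyp)
      (hΦ _ _ (hR.symm hzy)) (hR.symm h) (hΦ _ _ (hR.symm hzq))
  by_cases hxp : R x p
  · exact hΦ _ _ hxp
  by_cases hxq : R x q
  · exact cone (hR.not_symm hpq) (hR.symm h) x hxq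
  obtain ⟨y, hyx, hyp, hyq⟩ := hR.exists_common_not hxp (hR.ne_of_not hxq).symm
    (hR.ne_of_not hpq).symm
  obtain ⟨z, hzx, hzy, hzq⟩ := hR.exists_on_line (u := x) (v := y)
    (by rintro rfl; exact hxp hyp) (hR.symm hyx) q
  have hyz : y ≠ z := by rintro rfl; exact hyq hzq
  exact hR.line (hinj y z hyz (hR.symm hzy)) (hΦ _ _ (hR.symm hzy)) (hΦ _ _ (hR.symm hyx))
    (hΦ _ _ (hR.symm hzx)) (hΦ _ _ (hR.symm hyp))
    (hR.symm (cone (hR.not_symm hpq) (hR.symm h) z hzq))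

end IsMinkGeom
end

section

namespace Mink

lemma ip_smul_dir_self (k : ℝ) (o : Option ℂ) : ip (k • dir o) (k • dir o) = 0 := by
  rw [ip_smul_left, ip_smul_right, ip_dir_self, mul_zero, mul_zero]

lemma eq_smul_dir_of_orthogonal {v : Mink} {o : Option ℂ} (hv : ip v v = 0)
    (ho : ip (dir o) v = 0) : ∃ k : ℝ, v = k • dir o := by
  obtain ⟨k, o', rfl⟩ := exists_smul_dir hv
  by_cases h : o = o'
  · exact ⟨k, by rw [h]⟩
  · rw [ip_smul_right] at ho
    have hk : k = 0 := by simpa [ip_dir_ne_zero h] using ho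
    exact ⟨0, by simp [hk]⟩

lemma eq_zero_of_null_of_orthogonal {v : Mink} {o o' : Option ℂ} (hne : o ≠ o') (hv : ip v v = 0)
    (ho : ip (dir o) v = 0) (ho' : ip (dir o') v = 0) : v = 0 := by
  obtain ⟨k, rfl⟩ := eq_smul_dir_of_orthogonal hv ho
  rw [ip_smul_right] at ho'
  have hk : k = 0 := by simpa [ip_dir_ne_zero hne.symm] using ho'
  simp [hk]

lemma smul_dir_some (k : ℝ) (z : ℂ) : k • dir (some z) = (k / 2) • dir (some (z + 1)) +
    (k / 2) • dir (some (z - 1)) + (-k) • dir none := by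
  ext <;> simp [dir, Complex.normSq_apply] <;> ring

lemma smul_dir_none (k : ℝ) : k • dir none = (k / 2) • dir (some 1) +
    (k / 2) • dir (some (-1)) + (-k) • dir (some 0) := by
  ext <;> simp [dir]

/-- A map carrying lightlike lines to lightlike lines, with direction depending injectively on the
direction of the line, is additive. -/
lemma map_add_of_lightlike {G : Mink → Mink} {σ : Option ℂ → Option ℂ}
    (hσ : Function.Injective σ) (hG0 : G 0 = 0)
    (hG : ∀ A o (k : ℝ), ∃ k' : ℝ, G (A + k • dir o) = G A + k' • dir (σ o)) (A B : Mink) :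
    G (A + B) = G A + G B := by
  choose D hD using hG
  have hpar : ∀ A o o' (k k' : ℝ), o ≠ o' → D (A + k' • dir o') o k = D A o k := by
    intro A o o' k k' hne
    have h1 := hD (A + k' • dir o') o k
    rw [add_right_comm, hD (A + k • dir o), hD A o k, hD A o' k'] at h1
    have h2 := congrArg (ip (dir (σ o'))) h1
    simp only [ip_add_right, ip_smul_right, ip_dir_self] at h2
    have h3 := ip_dir_ne_zero (hσ.ne hne.symm)
    apply mul_right_cancel₀ h3
    linarith
  have hself : ∀ A o (k k' : ℝ), D (A + k' • dir o) o k = D A o k := by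
    intro A o k k'
    cases o with
    | none =>
      rw [smul_dir_none, ← add_assoc, ← add_assoc, hpar _ _ _ _ _ (by simp),
        hpar _ _ _ _ _ (by simp), hpar _ _ _ _ _ (by simp)]
    | some z =>
      rw [smul_dir_some, ← add_assoc, ← add_assoc, hpar _ _ _ _ _ (by simp),
        hpar _ _ _ _ _ (by simp [sub_eq_add_neg]), hpar _ _ _ _ _ (by simp)]
  have hstep : ∀ A o o' (k k' : ℝ), D (A + k' • dir o') o k = D A o k := by
    intro A o o' k k'
    by_cases h : o = o'
    · rw [← h, hself]
    · exact hpar A o o' k k' h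
  have hconst : ∀ A o k, D A o k = D 0 o k := by
    intro A o k
    obtain ⟨x, y, z, w, hA⟩ := eq_sum_dir A
    rw [hA, hstep, hstep, hstep, ← zero_add (x • dir none), hstep]
  have hadd : ∀ A o (k : ℝ), G (A + k • dir o) = G A + G (k • dir o) := by
    intro A o k
    have := hD 0 o k
    rw [zero_add, hG0, zero_add] at this
    rw [hD, this, hconst]
  obtain ⟨x, y, z, w, hB⟩ := eq_sum_dir B
  rw [hB, ← add_assoc, ← add_assoc, ← add_assoc]
  simp only [hadd]
  simp only [add_assoc]

/-- An additive map that preserves nullity in both directions is injective. -/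
lemma injective_of_null_iff {G : Mink →+ Mink} (hG : ∀ A, ip A A = 0 ↔ ip (G A) (G A) = 0) :
    Function.Injective G := by
  rw [injective_iff_map_eq_zero]
  intro A hA
  by_contra hne
  obtain ⟨o, ho⟩ := exists_dir_ip_ne_zero hne
  have hAA : ip A A = 0 := (hG A).2 (by rw [hA]; simp [ip])
  have h1 : ip (A + dir o) (A + dir o) = 0 := by
    rw [hG, map_add, hA, zero_add, ← hG, ip_dir_self]
  rw [ip_add_left, ip_add_right, ip_add_right, hAA, ip_dir_self, ip_comm A (dir o)] at h1
  exact ho (by linarith)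

/-- Two additive functions with `f a * g b` depending only on `a * b ≥ 0` are proportional to the
identity. -/
lemma eq_mul_of_mul_eq {f g : ℝ →+ ℝ} (hf : f 1 ≠ 0) (hg : g 1 ≠ 0)
    (hfg : ∀ a b c d, a * b = c * d → 0 ≤ a * b → f a * g b = f c * g d) (a : ℝ) :
    f a = a * f 1 ∧ g a = a * g 1 := by
  have hpos : ∀ t, 0 ≤ t → f t * g 1 = f 1 * g t := fun t ht =>
    hfg t 1 1 t (by ring) (by simpa)
  have hall : ∀ t, f t * g 1 = f 1 * g t := by
    intro t
    rcases le_total 0 t with h | h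
    · exact hpos t h
    · have := hpos (-t) (by linarith)
      simp only [map_neg] at this
      linarith
  have hmulpos : ∀ a b, 0 ≤ a * b → f 1 * f (a * b) = f a * f b := by
    intro a b h
    have h1 := hfg (a * b) 1 a b (by ring) (by simpa)
    have h2 := hall b
    apply mul_right_cancel₀ hg
    calc f 1 * f (a * b) * g 1 = f 1 * (f (a * b) * g 1) := by ring
      _ = f a * (f 1 * g b) := by rw [h1]; ring
      _ = f a * f b * g 1 := by rw [← h2]; ring
  have hmul : ∀ a b, f 1 * f (a * b) = f a * f b := by
    intro a b
    rcases le_total 0 (a * b) with h | h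
    · exact hmulpos a b h
    · have := hmulpos (-a) b (by linarith)
      rw [neg_mul] at this
      simp only [map_neg] at this
      linarith
  let ρ : ℝ →+* ℝ :=
    { toFun := fun t => f t / f 1
      map_one' := div_self hf
      map_zero' := by simp
      map_add' := fun x y => by simp [add_div]
      map_mul' := fun x y => by
        have := hmul x y
        field_simp
        linarith }
  have hρ : ρ = RingHom.id ℝ := Subsingleton.elim _ _
  have h1 : f a / f 1 = a := congrArg (fun r : ℝ →+* ℝ => r a) hρ
  have h2 : f a = a * f 1 := (div_eq_iff hf).1 h1
  refine ⟨h2, mul_left_cancel₀ hf ?_⟩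
  rw [← hall, h2]; ring

/-- An additive map preserving nullity in both directions and mapping null lines into null lines
is surjective. -/
lemma surjective_of_null_iff {G : Mink →+ Mink} {σ : Option ℂ → Option ℂ}
    (hσ : Function.Injective σ) (hG : ∀ A, ip A A = 0 ↔ ip (G A) (G A) = 0)
    (hdir : ∀ o (k : ℝ), ∃ k' : ℝ, G (k • dir o) = k' • dir (σ o)) :
    Function.Surjective G := by
  have hinj := injective_of_null_iff hG
  choose D hD using hdir
  have hDadd : ∀ o x y, D o (x + y) = D o x + D o y := by
    intro o x y
    have h := hD o (x + y)
    rw [add_smul, map_add, hD, hD, ← add_smul] at h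
    exact (smul_left_injective ℝ (dir_ne_zero _) h).symm
  have hD0 : ∀ o k, k ≠ 0 → D o k ≠ 0 := by
    intro o k hk h
    have h1 := hD o k
    rw [h, zero_smul, map_eq_zero_iff G hinj, smul_eq_zero] at h1
    exact h1.elim hk (dir_ne_zero o)
  let φ : Option ℂ → ℝ →+ ℝ := fun o => AddMonoidHom.mk' (D o) (hDadd o)
  have hφ : ∀ o k, G (k • dir o) = φ o k • dir (σ o) := hD
  have hφ0 : ∀ o k, k ≠ 0 → φ o k ≠ 0 := hD0
  set m := dir (σ none) with hm
  set m' := dir (σ (some 0)) with hm'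
  have hmm : ip m m' ≠ 0 := ip_dir_ne_zero (hσ.ne (by simp))
  have split : ∀ (a g : ℝ) (β : ℂ),
      ((a, g, β) : Mink) = a • dir none + g • dir (some 0) + ((0, 0, β) : Mink) := by
    intro a g β
    ext <;> simp [dir]
  let l : ℂ → Mink := fun β => G (0, 0, β)
  have hGsplit : ∀ (a g : ℝ) (β : ℂ),
      G (a, g, β) = φ none a • m + φ (some 0) g • m' + l β := by
    intro a g β
    rw [split, map_add, map_add, hφ, hφ]
  have hladd : ∀ β γ, l (β + γ) = l β + l γ := by
    intro β γ
    simp only [l]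
    rw [← map_add]; simp
  have hlneg : ∀ β, l (-β) = (-1 : ℝ) • l β := by
    intro β
    simp only [l]
    rw [neg_one_smul, ← map_neg]; simp
  have hexp : ∀ (a g : ℝ) (β : ℂ), a * g = Complex.normSq β →
      2 * (φ none a * φ (some 0) g * ip m m') + 2 * (φ none a * ip m (l β)) +
        2 * (φ (some 0) g * ip m' (l β)) + ip (l β) (l β) = 0 := by
    intro a g β h
    have h1 : ip (G (a, g, β)) (G (a, g, β)) = 0 := by
      rw [← hG]
      simp only [ip]
      rw [Complex.normSq_apply] at h
      linarith
    rw [hGsplit] at h1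
    simp only [ip_add_left, ip_add_right, ip_smul_left, ip_smul_right, ip_comm m' m,
      ip_comm (l β) m, ip_comm (l β) m'] at h1
    rw [hm, hm', ip_dir_self, ip_dir_self, ← hm, ← hm'] at h1
    linarith
  have hodd : ∀ (a g : ℝ) (β : ℂ), a * g = Complex.normSq β →
      φ none a * ip m (l β) + φ (some 0) g * ip m' (l β) = 0 := by
    intro a g β h
    have h1 := hexp a g β h
    have h2 := hexp a g (-β) (by rw [Complex.normSq_neg, h])
    rw [hlneg] at h2
    simp only [ip_smul_left, ip_smul_right] at h2
    linarith
  have horth : ∀ β, ip m (l β) = 0 ∧ ip m' (l β) = 0 := by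
    intro β
    by_cases hβ : β = 0
    · have : l β = 0 := by
        have := hladd 0 0
        rw [add_zero, left_eq_add] at this
        rw [hβ, this]
      rw [this]
      simp [ip]
    have hn : Complex.normSq β ≠ 0 := by simpa using hβ
    have h1 := hodd 1 (Complex.normSq β) β (by ring)
    have h2 := hodd (1 + 1) (Complex.normSq β / 2) β (by ring)
    have h3 : φ (some 0) (Complex.normSq β) = φ (some 0) (Complex.normSq β / 2) +
        φ (some 0) (Complex.normSq β / 2) := by rw [← map_add]; congr 1; ring
    rw [map_add] at h2
    rw [h3] at h1
    have h4 : φ none 1 * ip m (l β) = 0 := by linarith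
    have h5 := (mul_eq_zero.1 h4).resolve_left (hφ0 _ _ one_ne_zero)
    refine ⟨h5, ?_⟩
    rw [h5, mul_zero, zero_add, add_mul, add_self_eq_zero] at h1
    exact (mul_eq_zero.1 h1).resolve_left (hφ0 _ _ (div_ne_zero hn two_ne_zero))
  have hlnorm : ∀ (a g : ℝ) (β : ℂ), a * g = Complex.normSq β →
      ip (l β) (l β) = - (2 * (φ none a * φ (some 0) g * ip m m')) := by
    intro a g β h
    have := hexp a g β h
    rw [(horth β).1, (horth β).2] at this
    linarith
  have hprop : ∀ a, φ none a = a * φ none 1 ∧ φ (some 0) a = a * φ (some 0) 1 := by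
    refine eq_mul_of_mul_eq (hφ0 _ _ one_ne_zero) (hφ0 _ _ one_ne_zero) ?_
    intro a b c d h hab
    have hs : Complex.normSq (Real.sqrt (a * b) : ℂ) = a * b := by
      rw [Complex.normSq_ofReal, Real.mul_self_sqrt hab]
    have h1 := hlnorm a b _ hs.symm
    have h2 := hlnorm c d _ (h.symm.trans hs.symm)
    rw [h1] at h2
    apply mul_right_cancel₀ hmm
    linarith
  set p := φ none 1 * φ (some 0) 1 * ip m m' with hp
  have hlnorm' : ∀ β, ip (l β) (l β) = -2 * p * Complex.normSq β := by
    intro β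
    rw [hlnorm 1 (Complex.normSq β) β (by ring), (hprop (Complex.normSq β)).2, hp]
    ring
  have hsmul : ∀ (x : ℝ) β, l (x * β) = x • l β := by
    intro x β
    have h1 := hlnorm' (x * β + β)
    rw [hladd, ip_add_left, ip_add_right, ip_add_right, hlnorm', hlnorm', ip_comm (l β)] at h1
    have hx : Complex.normSq (x * β) = x ^ 2 * Complex.normSq β := by
      rw [Complex.normSq_mul, Complex.normSq_ofReal]; ring
    have hx' : Complex.normSq (x * β + β) = (x + 1) ^ 2 * Complex.normSq β := by
      rw [show (x * β + β : ℂ) = ((x + 1 : ℝ) : ℂ) * β by push_cast; ring, Complex.normSq_mul,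
        Complex.normSq_ofReal]; ring
    rw [hx, hx'] at h1
    rw [← sub_eq_zero]
    refine eq_zero_of_null_of_orthogonal (o := σ none) (o' := σ (some 0)) (hσ.ne (by simp)) ?_ ?_ ?_
    · simp only [ip_sub_left, ip_sub_right, ip_smul_left, ip_smul_right, hlnorm', hx,
        ip_comm (l β) (l (x * β))]
      have h2 : ip (l (x * β)) (l β) = -2 * p * x * Complex.normSq β := by linarith
      rw [h2]
      ring
    · rw [ip_sub_right, ip_smul_right, ← hm, (horth _).1, (horth _).1]; ring
    · rw [ip_sub_right, ip_smul_right, ← hm', (horth _).2, (horth _).2]; ring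
  let L : Mink →ₗ[ℝ] Mink :=
    { toFun := G
      map_add' := map_add G
      map_smul' := by
        rintro x ⟨a, g, β⟩
        have : x • ((a, g, β) : Mink) = (x * a, x * g, (x : ℂ) * β) := by simp
        rw [this, hGsplit, hGsplit, hsmul, (hprop (x * a)).1, (hprop (x * g)).2, (hprop a).1,
          (hprop g).2]
        simp only [RingHom.id_apply, smul_add, smul_smul, mul_assoc] }
  exact LinearMap.surjective_of_injective (f := L) hinj

end Mink

namespace IsMinkGeom

open Mink

variable {P : Type*} {R : P → P → Prop} {Φ : P → P}

/-- A map preserving coherency in both directions is bijective. -/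
lemma bijective_of_iff (hR : IsMinkGeom R) (hΦ : ∀ p q, R p q ↔ R (Φ p) (Φ q)) :
    Function.Bijective Φ := by
  have hinj : Function.Injective Φ := by
    intro p q h
    by_contra hne
    obtain ⟨r, h1, h2⟩ := hR.exists_coherent_not hne
    exact h2 ((hΦ r q).2 (h ▸ (hΦ r p).1 h1))
  have hsurj : ∀ x q, ¬ R (Φ x) q → q ∈ Set.range Φ := by
    intro x q hq
    obtain ⟨c⟩ := hR.chart x
    obtain ⟨c'⟩ := hR.chart (Φ x)
    have hF : ∀ A, ∃ B, Φ (c.aff A) = c'.aff B := fun A =>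
      c'.exists_aff hR fun h => c.not_base_aff A ((hΦ _ _).2 h)
    choose F hF using hF
    have hI : ∀ o k, ∃ o' k', Φ (c.inf o k) = c'.inf o' k' := fun o k =>
      c'.exists_inf ((hΦ _ _).1 (c.base_inf o k)) (hinj.ne (c.base_ne_inf o k))
    choose σ κ hI using hI
    have hσ0 : ∀ o k, σ o k = σ o 0 := by
      intro o k
      rw [← c'.inf_inf _ (κ o k) _ (κ o 0), ← hI, ← hI, ← hΦ, c.inf_inf]
    have hσ : Function.Injective fun o => σ o 0 := by
      intro o o' h
      have h : σ o 0 = σ o' 0 := h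
      rwa [← c'.inf_inf _ (κ o 0) _ (κ o' 0), ← hI, ← hI, ← hΦ, c.inf_inf] at h
    have hnull : ∀ A B, ip (A - B) (A - B) = 0 ↔ ip (F A - F B) (F A - F B) = 0 := by
      intro A B
      rw [← c.aff_aff, ← c'.aff_aff, ← hF, ← hF, ← hΦ]
    have hip : ∀ A o k, ip (dir o) A = k → ip (dir (σ o 0)) (F A) = κ o k := by
      intro A o k h
      rw [← hσ0 o k, ← c'.aff_inf, ← hF, ← hI, ← hΦ, c.aff_inf, h]
    have hline : ∀ A o (k : ℝ), ∃ k' : ℝ, F (A + k • dir o) = F A + k' • dir (σ o 0) := by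
      intro A o k
      obtain ⟨k', hk'⟩ := eq_smul_dir_of_orthogonal (v := F (A + k • dir o) - F A) (o := σ o 0)
        (by rw [← hnull, add_sub_cancel_left, ip_smul_dir_self]) (by
          rw [ip_sub_right, hip A o _ rfl, hip (A + k • dir o) o (ip (dir o) A), sub_self]
          rw [ip_add_right, ip_smul_right, ip_dir_self, mul_zero, add_zero])
      exact ⟨k', by rw [← hk']; abel⟩
    let G : Mink →+ Mink := AddMonoidHom.mk' (fun A => F A - F 0) fun A B =>
      map_add_of_lightlike (G := fun A => F A - F 0) hσ (sub_self _) (fun A o k => by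
        obtain ⟨k', hk'⟩ := hline A o k
        exact ⟨k', by rw [hk']; abel⟩) A B
    have hGF : ∀ A, G A = F A - F 0 := fun A => rfl
    have hGsurj : Function.Surjective G := by
      refine surjective_of_null_iff hσ (fun A => ?_) fun o k => ?_
      · rw [hGF, ← hnull, sub_zero]
      · obtain ⟨k', hk'⟩ := hline 0 o k
        exact ⟨k', by rw [hGF, ← zero_add (k • dir o), hk', add_sub_cancel_left]⟩
    obtain ⟨B, rfl⟩ := c'.exists_aff hR hq
    obtain ⟨A, hA⟩ := hGsurj (B - F 0)
    rw [hGF, sub_left_inj] at hA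
    exact ⟨c.aff A, by rw [hF, hA]⟩
  refine ⟨hinj, fun q => ?_⟩
  obtain ⟨x⟩ : Nonempty P := ⟨q⟩
  obtain ⟨r, h1, h2⟩ := hR.exists_opposite_both (Φ x) q
  obtain ⟨p, rfl⟩ := hsurj x r h1
  exact hsurj p q (hR.not_symm h2)

/-- A coherency preserver is either bijective and coherency preserving in both directions, or
degenerate. -/
lemma bijective_or_degenerate (hR : IsMinkGeom R) (hΦ : ∀ p q, R p q → R (Φ p) (Φ q)) :
    (Function.Bijective Φ ∧ ∀ p q, R p q ↔ R (Φ p) (Φ q)) ∨ IsDegenerate R Φ := by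
  by_cases hinj : ∀ a b, a ≠ b → R a b → Φ a ≠ Φ b
  · by_cases hiff : ∀ p q, R (Φ p) (Φ q) → R p q
    · have h : ∀ p q, R p q ↔ R (Φ p) (Φ q) := fun p q => ⟨hΦ p q, hiff p q⟩
      exact Or.inl ⟨hR.bijective_of_iff h, h⟩
    · push Not at hiff
      obtain ⟨p, q, h1, h2⟩ := hiff
      exact Or.inr (hR.degenerate_of_map_coherent hΦ hinj h2 h1)
  · push Not at hinj
    obtain ⟨a, b, h1, h2, h3⟩ := hinj
    exact Or.inr (hR.degenerate_of_map_eq hΦ h1 h2 h3)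

end IsMinkGeom
end

/-- A chart can be transported along a bijection preserving the coherency relation. -/
def MinkChart.map {P : Type*} {R : P → P → Prop} {x : P} (c : MinkChart R x) (f : P ≃ P)
    (hf : ∀ p q, R (f p) (f q) ↔ R p q) : MinkChart R (f x) where
  aff A := f (c.aff A)
  inf o k := f (c.inf o k)
  not_base_aff A := by rw [hf]; exact c.not_base_aff A
  base_inf o k := by rw [hf]; exact c.base_inf o k
  base_ne_inf o k := f.injective.ne (c.base_ne_inf o k)
  aff_aff A B := by rw [hf]; exact c.aff_aff A B
  aff_inf A o k := by rw [hf]; exact c.aff_inf A o k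
  inf_inf o k o' k' := by rw [hf]; exact c.inf_inf o k o' k'
  exhaust p := by
    obtain ⟨p, rfl⟩ := f.surjective p
    simpa only [f.injective.eq_iff] using c.exhaust p

lemma rank_le_one_iff_det_eq_zero (M : Mat2) : M.rank ≤ 1 ↔ M.det = 0 := by
  constructor
  · intro h
    by_contra hdet
    have := Matrix.rank_of_isUnit M ((Matrix.isUnit_iff_isUnit_det M).2 (isUnit_iff_ne_zero.2 hdet))
    simp at this
    omega
  · intro h
    by_contra hr
    obtain ⟨v, hv, hMv⟩ := Matrix.exists_mulVec_eq_zero_iff.2 h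
    have h2 : M.rank = 2 := le_antisymm (by simpa using M.rank_le_card_width) (by omega)
    have h3 := LinearMap.finrank_range_add_finrank_ker M.mulVecLin
    rw [← Matrix.rank, h2] at h3
    simp only [Module.finrank_fintype_fun_eq_card, Fintype.card_fin, Nat.add_eq_left,
      Submodule.finrank_eq_zero] at h3
    exact hv (LinearMap.ker_eq_bot'.1 h3 v (by simpa using hMv))

lemma coherentU_iff_det (U V : U2) : CoherentU U V ↔ ((U : Mat2) - (V : Mat2)).det = 0 :=
  rank_le_one_iff_det_eq_zero _

lemma coherentU_comm {U V : U2} : CoherentU U V ↔ CoherentU V U := by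
  rw [coherentU_iff_det, coherentU_iff_det, ← neg_sub, det_neg]
  simp

namespace U2Chart

open Mink ComplexConjugate

/-- The scalar part of the conformal parametrization of `U₂`. -/
def scal (s t : ℝ) (A : Mink) : ℂ := ⟨(s - t) / 2, (A.1 + A.2.1) / 2⟩

/-- The diagonal part of the conformal parametrization of `U₂`. -/
def diagPart (s t : ℝ) (A : Mink) : ℂ := ⟨(s + t) / 2, (A.1 - A.2.1) / 2⟩

/-- The scaled element of `SU₂` with first row `p`, `q`. -/
def scaledSU (w p q : ℂ) : Mat2 := (conj w)⁻¹ • !![p, q; -conj q, conj p]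

/-- The conformal parametrization of `U₂` by a quadric in projective space. -/
def confMat (s t : ℝ) (A : Mink) : Mat2 := scaledSU (scal s t A) (diagPart s t A) A.2.2

lemma scaledSU_mem {w p q : ℂ} (hw : w ≠ 0) (h : w * conj w = p * conj p + q * conj q) :
    scaledSU w p q ∈ Matrix.unitaryGroup (Fin 2) ℂ := by
  have hw' : conj w ≠ 0 := by simpa using hw
  rw [Matrix.mem_unitaryGroup_iff]
  ext i j
  fin_cases i <;> fin_cases j <;>
    simp [scaledSU, Matrix.mul_apply, Fin.sum_univ_two, Matrix.star_apply] <;>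
    field_simp <;> first | ring1 | linear_combination -h

lemma det_scaledSU_sub {w p q w' p' q' : ℂ} (hw : w ≠ 0) (hw' : w' ≠ 0)
    (h : w * conj w = p * conj p + q * conj q) (h' : w' * conj w' = p' * conj p' + q' * conj q') :
    (scaledSU w p q - scaledSU w' p' q').det = (conj w)⁻¹ * (conj w')⁻¹ *
      (w * conj w' + w' * conj w - p * conj p' - conj p * p' - q * conj q' - conj q * q') := by
  have hi : conj w * (conj w)⁻¹ = 1 := mul_inv_cancel₀ (by simpa using hw)
  have hi' : conj w' * (conj w')⁻¹ = 1 := mul_inv_cancel₀ (by simpa using hw')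
  rw [Matrix.det_fin_two]
  simp only [scaledSU, Matrix.sub_apply, Matrix.smul_apply, Matrix.of_apply, Matrix.cons_val',
    Matrix.cons_val_zero, Matrix.cons_val_one, Matrix.cons_val_fin_one, smul_eq_mul]
  generalize (conj w)⁻¹ = i at *
  generalize (conj w')⁻¹ = i' at *
  linear_combination (-i ^ 2) * h + (-i' ^ 2) * h' + (i * w) * hi - (i * w) * hi' +
    (i' * w') * hi' - (i' * w') * hi

lemma normSq_scal {s t : ℝ} {A : Mink} (h : ip A A = 2 * s * t) :
    scal s t A * conj (scal s t A) =
      diagPart s t A * conj (diagPart s t A) + A.2.2 * conj A.2.2 := by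
  simp only [Complex.mul_conj, ← Complex.ofReal_add, Complex.ofReal_inj, Complex.normSq_apply,
    scal, diagPart]
  simp only [ip] at h
  linarith

lemma det_confMat_sub_eq_zero_iff {s t s' t' : ℝ} {A A' : Mink} (hA : ip A A = 2 * s * t)
    (hA' : ip A' A' = 2 * s' * t') (hw : scal s t A ≠ 0) (hw' : scal s' t' A' ≠ 0) :
    (confMat s t A - confMat s' t' A').det = 0 ↔ ip A A' = s * t' + s' * t := by
  rw [confMat, confMat, det_scaledSU_sub hw hw' (normSq_scal hA) (normSq_scal hA')]
  have key : scal s t A * conj (scal s' t' A') + scal s' t' A' * conj (scal s t A) -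
      diagPart s t A * conj (diagPart s' t' A') - conj (diagPart s t A) * diagPart s' t' A' -
      A.2.2 * conj A'.2.2 - conj A.2.2 * A'.2.2 = ((ip A A' - (s * t' + s' * t) : ℝ) : ℂ) := by
    apply Complex.ext
    · simp [scal, diagPart, ip]; ring
    · simp [scal, diagPart, ip]; ring
  rw [key]
  simp [hw, hw', sub_eq_zero, -Complex.ofReal_sub, -Complex.ofReal_add]

lemma scaledSU_smul {c : ℝ} (hc : c ≠ 0) (w p q : ℂ) :
    scaledSU (c * w) (c * p) (c * q) = scaledSU w p q := by
  have hc' : (c : ℂ) ≠ 0 := by simpa using hc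
  ext i j
  fin_cases i <;> fin_cases j <;> simp [scaledSU] <;> field_simp

lemma confMat_smul {c : ℝ} (hc : c ≠ 0) (s t : ℝ) (A : Mink) :
    confMat (c * s) (c * t) (c • A) = confMat s t A := by
  rw [confMat, confMat, ← scaledSU_smul hc (scal s t A)]
  congr 1
  · apply Complex.ext <;> simp [scal] <;> ring
  · apply Complex.ext <;> simp [diagPart] <;> ring

lemma scal_aff_ne_zero (A : Mink) : scal (ip A A / 2) 1 A ≠ 0 := by
  intro h
  have h1 := congrArg Complex.re h
  have h2 := congrArg Complex.im h
  simp only [scal, Complex.zero_re, Complex.zero_im, ip] at h1 h2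
  have h3 : A.2.1 = -A.1 := by linarith
  rw [h3] at h1
  nlinarith [sq_nonneg A.1, sq_nonneg A.2.2.re, sq_nonneg A.2.2.im]

lemma scal_inf_ne_zero (o : Option ℂ) (k : ℝ) : scal k 0 (dir o) ≠ 0 := by
  intro h
  have h2 := congrArg Complex.im h
  cases o with
  | none => simp [scal, dir] at h2
  | some z =>
    simp only [scal, dir, Complex.zero_im] at h2
    linarith [Complex.normSq_nonneg z]

lemma confMat_one : confMat 1 0 0 = 1 := by
  ext i j
  have h1 : scal 1 0 0 = ((1 / 2 : ℝ) : ℂ) := by apply Complex.ext <;> simp [scal]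
  have h2 : diagPart 1 0 0 = ((1 / 2 : ℝ) : ℂ) := by apply Complex.ext <;> simp [diagPart]
  rw [confMat, h1, h2]
  fin_cases i <;> fin_cases j <;> simp [scaledSU, -Complex.ofReal_div, -Complex.ofReal_inv,
    Complex.conj_ofReal]

/-- The unitary matrices not coherent with the identity. -/
def aff (A : Mink) : U2 :=
  ⟨confMat (ip A A / 2) 1 A, scaledSU_mem (scal_aff_ne_zero A) (normSq_scal (by ring))⟩

/-- The unitary matrices coherent with the identity and different from it. -/
def inf (o : Option ℂ) (k : ℝ) : U2 :=
  ⟨confMat k 0 (dir o), scaledSU_mem (scal_inf_ne_zero o k)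
    (normSq_scal (by rw [ip_dir_self]; ring))⟩

lemma exists_scaledSU (U : U2) : ∃ w p q : ℂ, w ≠ 0 ∧ w * conj w = p * conj p + q * conj q ∧
    (U : Mat2) = scaledSU w p q := by
  have hU : (U : Mat2) * star (U : Mat2) = 1 := Matrix.mem_unitaryGroup_iff.1 U.2
  have hadj : adjugate (U : Mat2) = (U : Mat2).det • star (U : Mat2) := by
    calc adjugate (U : Mat2) = adjugate (U : Mat2) * ((U : Mat2) * star (U : Mat2)) := by
          rw [hU, mul_one]
      _ = _ := by rw [← mul_assoc, adjugate_mul, smul_mul_assoc, one_mul]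
  obtain ⟨w, hw⟩ := IsAlgClosed.exists_pow_nat_eq (U : Mat2).det (n := 2) (by norm_num)
  have hdet : (U : Mat2).det * conj (U : Mat2).det = 1 := by
    have := congrArg Matrix.det hU
    rwa [det_mul, star_eq_conjTranspose, det_conjTranspose, det_one] at this
  have hww : w * conj w = 1 := by
    rw [← hw, map_pow, ← mul_pow, Complex.mul_conj, ← Complex.ofReal_pow, Complex.ofReal_eq_one,
      pow_eq_one_iff_of_nonneg (Complex.normSq_nonneg w) two_ne_zero] at hdet
    rw [Complex.mul_conj, hdet, Complex.ofReal_one]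
  have hw0 : w ≠ 0 := left_ne_zero_of_mul_eq_one hww
  have hcw : (conj w)⁻¹ = w := inv_eq_of_mul_eq_one_left hww
  have hrow := congrFun (congrFun hU 0) 0
  have h00 := congrFun (congrFun hadj 0) 0
  have h10 := congrFun (congrFun hadj 1) 0
  simp [adjugate_fin_two, Matrix.mul_apply, Fin.sum_univ_two, Matrix.star_apply, ← hw]
    at hrow h00 h10
  refine ⟨w, conj w * (U : Mat2) 0 0, conj w * (U : Mat2) 0 1, hw0, ?_, ?_⟩
  · simp only [map_mul, Complex.conj_conj]
    linear_combination (-(w * conj w)) * hrow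
  · ext i j
    fin_cases i <;> fin_cases j <;> simp [scaledSU, hcw]
    · linear_combination (-(U : Mat2) 0 0) * hww
    · linear_combination (-(U : Mat2) 0 1) * hww
    · linear_combination -h10
    · linear_combination h00

lemma exists_confMat (U : U2) : ∃ (s t : ℝ) (A : Mink), ip A A = 2 * s * t ∧ scal s t A ≠ 0 ∧
    (U : Mat2) = confMat s t A := by
  obtain ⟨w, p, q, hw, h, hU⟩ := exists_scaledSU U
  have h1 : scal (w.re + p.re) (p.re - w.re) (w.im + p.im, w.im - p.im, q) = w := by
    apply Complex.ext <;> simp [scal]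
    ring
  have h2 : diagPart (w.re + p.re) (p.re - w.re) (w.im + p.im, w.im - p.im, q) = p := by
    apply Complex.ext <;> simp [diagPart]
    ring
  refine ⟨w.re + p.re, p.re - w.re, (w.im + p.im, w.im - p.im, q), ?_, by rwa [h1], ?_⟩
  · simp only [Complex.mul_conj, ← Complex.ofReal_add, Complex.ofReal_inj,
      Complex.normSq_apply] at h
    simp only [ip]
    linarith
  · rw [confMat, h1, h2, hU]

lemma scal_one_ne_zero : scal 1 0 0 ≠ 0 := by
  intro h
  simpa [scal] using congrArg Complex.re h

lemma coherentU_one_aff (A : Mink) : ¬ CoherentU 1 (aff A) := by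
  rw [coherentU_iff_det, UnitaryGroup.one_val, ← confMat_one, aff,
    det_confMat_sub_eq_zero_iff (by simp [ip]) (by ring) scal_one_ne_zero (scal_aff_ne_zero A)]
  simp [ip]

lemma coherentU_aff_inf (A : Mink) (o : Option ℂ) (k : ℝ) :
    CoherentU (aff A) (inf o k) ↔ ip (dir o) A = k := by
  rw [coherentU_iff_det, aff, inf, det_confMat_sub_eq_zero_iff (by ring)
    (by rw [ip_dir_self]; ring) (scal_aff_ne_zero A) (scal_inf_ne_zero o k), ip_comm]
  simp

/-- The chart of `U₂` at the identity. -/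
def chartOne : MinkChart CoherentU (1 : U2) where
  aff := aff
  inf := inf
  not_base_aff := coherentU_one_aff
  base_inf o k := by
    rw [coherentU_iff_det, UnitaryGroup.one_val, ← confMat_one, inf,
      det_confMat_sub_eq_zero_iff (by simp [ip]) (by rw [ip_dir_self]; ring) scal_one_ne_zero
        (scal_inf_ne_zero o k)]
    simp [ip]
  base_ne_inf o k h := by
    obtain ⟨o', ho'⟩ := exists_ne o
    have h1 := (coherentU_aff_inf ((k / ip (dir o) (dir o')) • dir o') o k).2
      (by rw [ip_smul_right, div_mul_cancel₀ _ (ip_dir_ne_zero ho'.symm)])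
    rw [← h, coherentU_comm] at h1
    exact coherentU_one_aff _ h1
  aff_aff A B := by
    rw [coherentU_iff_det, aff, aff, det_confMat_sub_eq_zero_iff (by ring) (by ring)
      (scal_aff_ne_zero A) (scal_aff_ne_zero B)]
    simp only [ip_sub_left, ip_sub_right, ip_comm B A]
    constructor <;> intro h <;> linarith
  aff_inf := coherentU_aff_inf
  inf_inf o k o' k' := by
    rw [coherentU_iff_det, inf, inf, det_confMat_sub_eq_zero_iff (by rw [ip_dir_self]; ring)
      (by rw [ip_dir_self]; ring) (scal_inf_ne_zero o k) (scal_inf_ne_zero o' k')]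
    constructor
    · intro h
      by_contra hne
      exact ip_dir_ne_zero hne (by simpa using h)
    · rintro rfl
      simp [ip_dir_self]
  exhaust U := by
    obtain ⟨s, t, A, hA, hw, hU⟩ := exists_confMat U
    by_cases ht : t = 0
    · subst ht
      obtain ⟨k, o, rfl⟩ := exists_smul_dir (n := A) (by rw [hA]; ring)
      by_cases hk : k = 0
      · subst hk
        have hs : s ≠ 0 := by
          rintro rfl
          exact hw (by apply Complex.ext <;> simp [scal])
        left
        apply Subtype.ext
        rw [hU, UnitaryGroup.one_val, ← confMat_one, ← confMat_smul hs 1 0 0]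
        simp
      · right; right
        refine ⟨o, s / k, Subtype.ext ?_⟩
        rw [hU]
        change _ = confMat (s / k) 0 (dir o)
        rw [← confMat_smul hk (s / k), mul_zero, mul_div_cancel₀ _ hk]
    · right; left
      refine ⟨t⁻¹ • A, Subtype.ext ?_⟩
      rw [hU, aff, ← confMat_smul (inv_ne_zero ht) s]
      congr 1
      · rw [ip_smul_left, ip_smul_right, hA]
        field_simp
      · exact inv_mul_cancel₀ ht

end U2Chart

lemma coherentU_mul_left (W U V : U2) : CoherentU (W * U) (W * V) ↔ CoherentU U V := by
  rw [coherentU_iff_det, coherentU_iff_det, UnitaryGroup.mul_val, UnitaryGroup.mul_val, ← mul_sub,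
    det_mul, mul_eq_zero]
  exact or_iff_right (UnitaryGroup.det_isUnit W).ne_zero

lemma isMinkGeom_coherentU : IsMinkGeom CoherentU where
  refl U := by rw [coherentU_iff_det]; simp
  symm h := coherentU_comm.1 h
  chart U := ⟨by
    have c := U2Chart.chartOne.map (Equiv.mulLeft U) fun V W => coherentU_mul_left U V W
    simpa using c⟩

/-- Two distinct coherent unitaries span a line. -/
lemma isLine_span {U V : U2} (hne : U ≠ V) (h : CoherentU U V) :
    IsLine {W | CoherentU W U ∧ CoherentU W V} := by
  have hR := isMinkGeom_coherentU
  refine ⟨fun W hW W' hW' => hR.line hne h hW.1 hW.2 hW'.1 hW'.2, fun m hm hcl => ?_⟩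
  refine Set.Subset.antisymm (fun W hW => ?_) hm
  exact ⟨hcl W hW U (hm ⟨hR.refl U, h⟩), hcl W hW V (hm ⟨hR.symm h, hR.refl V⟩)⟩

/-- A coherency preserver of the whole of `U₂` is either an automorphism or degenerate. -/
theorem coherency_preserver_on_U2
    (Φ : U2 → U2)
    (hΦ : ∀ U V : U2, CoherentU U V → CoherentU (Φ U) (Φ V)) :
    IsAut Φ ∨
    (∃ A : U2, ∃ B ∈ Set.range Φ, ∀ U : U2, U ≠ A → CoherentU (Φ U) B) ∨
    (∃ ℓ ℓ' : Set U2, IsLine ℓ ∧ IsLine ℓ' ∧ ∀ U : U2, U ∉ ℓ → Φ U ∈ ℓ') := by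
  rcases isMinkGeom_coherentU.bijective_or_degenerate hΦ with h | h | ⟨u, v, u', v', h⟩
  · exact Or.inl h
  · exact Or.inr (Or.inl h)
  · obtain ⟨huv, ruv, huv', ruv', hmap⟩ := h
    exact Or.inr (Or.inr ⟨_, _, isLine_span huv ruv, isLine_span huv' ruv', hmap⟩)
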